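/- Let ψ₁, ψ₂ : ℕ → (0,∞) be approximating functions. If the series Σ_{h=1}^∞ ψ₁(h) ψ₂(h) converges, then ℋ¹(C_f ∩ S₂(ψ₁,ψ₂)) = 0; equivalently, the set of x ∈ I with (x, f(x)) ∈ S₂(ψ₁,ψ₂) has Lebesgue measure zero. -/

import Mathlib

open MeasureTheory Filter

/-- Distance from `x` to the nearest integer, `‖x‖ = min_{z ∈ ℤ} |x - z|`. -/
noncomputable def nint (x : ℝ) : ℝ := ⨅ z : ℤ, |x - (z : ℝ)|

/-- `S₂(ψ₁, ψ₂)`: points `(x, y) ∈ ℝ²` with `‖qx‖ < ψ₁(q)` and `‖qy‖ < ψ₂(q)` for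
infinitely many `q ∈ ℕ`. -/
def S2 (ψ₁ ψ₂ : ℕ → ℝ) : Set (EuclideanSpace ℝ (Fin 2)) :=
  { p | {q : ℕ | 0 < q ∧ nint (q * p 0) < ψ₁ q ∧ nint (q * p 1) < ψ₂ q}.Infinite }

theorem finite_ncard_le_of_separated {ι : Type*} (X : Set ι) (g : ι → ℝ) {d W : ℝ} (hd : 0 < d)
    (hW : 0 ≤ W) (hsep : ∀ i ∈ X, ∀ j ∈ X, i ≠ j → d ≤ |g i - g j|)
    (hdiam : ∀ i ∈ X, ∀ j ∈ X, |g i - g j| ≤ W) :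
    X.Finite ∧ (X.ncard : ℝ) ≤ 2 + 2 * W / d := by
  rcases X.eq_empty_or_nonempty with rfl | ⟨i₀, hi₀⟩
  · simp; positivity
  set T : Finset ℤ := Finset.Icc ⌊(-W) / d⌋ ⌊W / d⌋
  have hmaps : Set.MapsTo (fun i => ⌊(g i - g i₀) / d⌋) X (T : Set ℤ) := by
    intro i hi
    have h := abs_le.1 (hdiam i hi i₀ hi₀)
    simp only [T, Finset.coe_Icc, Set.mem_Icc]
    exact ⟨Int.floor_le_floor (by gcongr; linarith), Int.floor_le_floor (by gcongr; linarith)⟩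
  have hinj : Set.InjOn (fun i => ⌊(g i - g i₀) / d⌋) X := by
    intro i hi j hj hij
    by_contra hne
    have h1 := hsep i hi j hj hne
    have h2 := Int.abs_sub_lt_one_of_floor_eq_floor hij
    rw [← sub_div, abs_div, abs_of_pos hd, div_lt_one hd] at h2
    rw [sub_sub_sub_cancel_right] at h2
    linarith
  have hTfin : (T : Set ℤ).Finite := Finset.finite_toSet T
  refine ⟨Set.Finite.of_injOn hmaps hinj hTfin, ?_⟩
  have h1 : X.ncard ≤ T.card := by
    simpa [Set.ncard_coe_finset] using Set.ncard_le_ncard_of_injOn _ hmaps hinj hTfin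
  have h2 : (T.card : ℝ) ≤ 2 + 2 * W / d := by
    have h3 : ⌊(-W) / d⌋ ≤ ⌊W / d⌋ :=
      Int.floor_le_floor (div_le_div_of_nonneg_right (by linarith) hd.le)
    have h4 : (T.card : ℤ) = ⌊W / d⌋ + 1 - ⌊(-W) / d⌋ := by
      rw [Int.card_Icc, Int.toNat_of_nonneg (by linarith)]
    have h5 : (T.card : ℝ) = ⌊W / d⌋ + 1 - ⌊(-W) / d⌋ := by exact_mod_cast h4
    have h6 := Int.floor_le (W / d)
    have h7 := Int.lt_floor_add_one ((-W) / d)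
    have h8 : (-W) / d = -(W / d) := neg_div d W
    have h9 : 2 * W / d = 2 * (W / d) := mul_div_assoc 2 W d
    rw [h5]
    linarith
  exact le_trans (by exact_mod_cast h1) h2

theorem finite_ncard_le_of_det_le {ι : Type*} [Fintype ι] [DecidableEq ι] (S : Set (ι → ℤ)) (D : ℝ)
    (hD : ∀ f : ι → ι → ℤ, (∀ i, f i ∈ S) → |((Matrix.of f).det : ℝ)| ≤ D)
    (hne : ∃ f : ι → ι → ℤ, (∀ i, f i ∈ S) ∧ (Matrix.of f).det ≠ 0) :
    S.Finite ∧ (S.ncard : ℝ) ≤ 3 ^ Fintype.card ι * D := by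
  obtain ⟨f, ⟨hfS, hf0⟩, hmax⟩ : ∃ f : ι → ι → ℤ, ((∀ i, f i ∈ S) ∧ (Matrix.of f).det ≠ 0) ∧
      ∀ g : ι → ι → ℤ, (∀ i, g i ∈ S) → |(Matrix.of g).det| ≤ |(Matrix.of f).det| := by
    let P : ℤ → Prop := fun n => ∃ f : ι → ι → ℤ, (∀ i, f i ∈ S) ∧ |(Matrix.of f).det| = n
    obtain ⟨f₀, hf₀⟩ := hne
    obtain ⟨n, ⟨f, hfS, hfn⟩, hn⟩ := Int.exists_greatest_of_bdd (P := P)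
      ⟨⌊D⌋, fun z ⟨f, hf, hz⟩ => Int.le_floor.2 (by rw [← hz]; exact_mod_cast hD f hf)⟩
      ⟨_, f₀, hf₀.1, rfl⟩
    refine ⟨f, ⟨hfS, ?_⟩, fun g hg => hfn ▸ hn _ ⟨g, hg, rfl⟩⟩
    have := hn _ ⟨f₀, hf₀.1, rfl⟩
    rw [← hfn] at this
    exact abs_pos.1 (lt_of_lt_of_le (abs_pos.2 hf₀.2) this)
  set A : Matrix ι ι ℤ := Matrix.of f with hA
  set Δ := A.det with hΔ
  have hli : LinearIndependent ℤ f := Matrix.linearIndependent_rows_of_det_ne_zero hf0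
  set N : Submodule ℤ (ι → ℤ) := Submodule.span ℤ (Set.range f) with hN
  have hcard : Nat.card ((ι → ℤ) ⧸ N) = Δ.natAbs := by
    rw [← Submodule.natAbs_det_basis_change (Pi.basisFun ℤ ι) N (Module.Basis.span hli)]
    rw [hΔ, hA, ← Pi.basisFun_det_apply]
    congr 2
    funext i
    exact congrArg Subtype.val (Module.Basis.span_apply hli i)
  have hΔ' : 0 < |Δ| := abs_pos.2 hf0
  have hfin : Finite ((ι → ℤ) ⧸ N) := Nat.finite_of_card_ne_zero (by rw [hcard]; simpa using hf0)
  let F : (ι → ℤ) → ((ι → ℤ) ⧸ N) × (ι → ℤ) :=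
    fun s => (Submodule.Quotient.mk s, fun i => A.transpose.cramer s i / |Δ|)
  let T : Set (((ι → ℤ) ⧸ N) × (ι → ℤ)) :=
    Set.univ ×ˢ ↑(Fintype.piFinset fun _ : ι => Finset.Icc (-1 : ℤ) 1)
  have hTfin : T.Finite := Set.finite_univ.prod (Finset.finite_toSet _)
  have hmaps : Set.MapsTo F S T := by
    intro s hs
    refine ⟨trivial, ?_⟩
    simp only [Finset.mem_coe, Fintype.mem_piFinset, Finset.mem_Icc, F]
    intro i
    have h1 : |A.transpose.cramer s i| ≤ |Δ| := by
      rw [Matrix.cramer_transpose_apply]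
      refine hmax (Function.update f i s) fun j => ?_
      by_cases hj : j = i
      · subst hj; simpa using hs
      · simpa [hj] using hfS j
    have h2 := abs_le.1 h1
    exact ⟨(Int.le_ediv_iff_mul_le hΔ').2 (by linarith), Int.ediv_le_of_le_mul hΔ' (by linarith)⟩
  have hinj : Set.InjOn F S := by
    intro s hs t ht hst
    simp only [F, Prod.mk.injEq] at hst
    obtain ⟨h1, h2⟩ := hst
    rw [Submodule.Quotient.eq, hN, Submodule.mem_span_range_iff_exists_fun] at h1
    obtain ⟨k, hk⟩ := h1
    have hk' : s - t = A.transpose.mulVec k := by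
      rw [← hk, Matrix.mulVec_transpose]
      ext j
      simp [Matrix.vecMul, dotProduct, hA]
    have h3 : A.transpose.cramer s - A.transpose.cramer t = Δ • k := by
      rw [← map_sub, hk', Matrix.cramer_eq_adjugate_mulVec, Matrix.mulVec_mulVec,
        Matrix.adjugate_mul, Matrix.det_transpose, Matrix.smul_mulVec, Matrix.one_mulVec]
    have hk0 : k = 0 := by
      funext i
      have h4 := congrFun h2 i
      have h5 := congrFun h3 i
      simp only [Pi.sub_apply, Pi.smul_apply, smul_eq_mul] at h5
      have h6 : |A.transpose.cramer s i - A.transpose.cramer t i| < |Δ| := by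
        have e1 := Int.emod_add_mul_ediv (A.transpose.cramer s i) |Δ|
        have e2 := Int.emod_add_mul_ediv (A.transpose.cramer t i) |Δ|
        have e3 := Int.emod_lt_of_pos (A.transpose.cramer s i) hΔ'
        have e4 := Int.emod_lt_of_pos (A.transpose.cramer t i) hΔ'
        have e5 := Int.emod_nonneg (A.transpose.cramer s i) hΔ'.ne'
        have e6 := Int.emod_nonneg (A.transpose.cramer t i) hΔ'.ne'
        rw [h4] at e1
        rw [abs_lt]
        constructor <;> linarith
      rw [h5, abs_mul] at h6
      by_contra h7
      have : 1 ≤ |k i| := Int.one_le_abs h7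
      nlinarith
    rw [hk0] at hk'
    simpa [sub_eq_zero] using hk'
  refine ⟨Set.Finite.of_injOn hmaps hinj hTfin, ?_⟩
  have h1 : S.ncard ≤ T.ncard := Set.ncard_le_ncard_of_injOn F hmaps hinj hTfin
  have h2 : T.ncard = Δ.natAbs * 3 ^ Fintype.card ι := by
    rw [Set.ncard_prod, Set.ncard_univ, hcard, Set.ncard_coe_finset, Fintype.card_piFinset]
    simp
  have h3 : ((Δ.natAbs : ℕ) : ℝ) ≤ D := by
    have := hD f hfS
    rwa [Nat.cast_natAbs, Int.cast_abs]
  rw [h2] at h1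
  calc (S.ncard : ℝ) ≤ ((Δ.natAbs * 3 ^ Fintype.card ι : ℕ) : ℝ) := by exact_mod_cast h1
    _ = 3 ^ Fintype.card ι * (Δ.natAbs : ℝ) := by push_cast; ring
    _ ≤ _ := by gcongr

theorem volume_le_of_pairwise_dist_le {s : Set ℝ} {d : ℝ}
    (h : ∀ x ∈ s, ∀ y ∈ s, |x - y| ≤ d) : volume s ≤ ENNReal.ofReal d := by
  refine (Real.volume_le_diam s).trans (Metric.ediam_le fun x hx y hy => ?_)
  rw [edist_dist, Real.dist_eq]
  exact ENNReal.ofReal_le_ofReal (h x hx y hy)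

/-- Reduces to the case `x ≤ y` in `volume_le_of_pairwise_dist_le`. -/
theorem volume_le_of_pairwise_sub_le {s : Set ℝ} {d : ℝ}
    (h : ∀ x ∈ s, ∀ y ∈ s, x ≤ y → y - x ≤ d) : volume s ≤ ENNReal.ofReal d := by
  refine volume_le_of_pairwise_dist_le fun x hx y hy => ?_
  rcases le_total x y with hxy | hxy
  · rw [abs_sub_comm, abs_of_nonneg (sub_nonneg.2 hxy)]
    exact h x hx y hy hxy
  · rw [abs_of_nonneg (sub_nonneg.2 hxy)]
    exact h y hy x hx hxy

theorem measure_le_of_subset_biUnion {α ι : Type*} [MeasurableSpace α] {μ : Measure α}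
    {T : Set α} {X : Set ι} (hX : X.Finite) {U : ι → Set α} {N m : ℝ} (hm : 0 ≤ m)
    (hN : (X.ncard : ℝ) ≤ N) (hT : T ⊆ ⋃ i ∈ X, U i)
    (hU : ∀ i ∈ X, μ (U i) ≤ ENNReal.ofReal m) : μ T ≤ ENNReal.ofReal (N * m) := by
  calc μ T ≤ μ (⋃ i ∈ hX.toFinset, U i) := measure_mono (by simpa using hT)
    _ ≤ ∑ i ∈ hX.toFinset, μ (U i) := measure_biUnion_finset_le _ _
    _ ≤ ∑ i ∈ hX.toFinset, ENNReal.ofReal m := Finset.sum_le_sum fun i hi => hU i (by simpa using hi)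
    _ = ENNReal.ofReal (X.ncard * m) := by
      rw [Finset.sum_const, nsmul_eq_mul, ENNReal.ofReal_mul (by positivity),
        ENNReal.ofReal_natCast, Set.ncard_eq_toFinset_card X hX]
    _ ≤ _ := ENNReal.ofReal_le_ofReal (by gcongr)

theorem volume_le_of_short_pieces {S : Set ℝ} {α ρ m : ℝ} (hρ : 0 < ρ) (hm : 0 ≤ m)
    (hS : S ⊆ Set.Icc α (α + 1))
    (h : ∀ T ⊆ S, (∀ x ∈ T, ∀ y ∈ T, |x - y| ≤ ρ) → volume T ≤ ENNReal.ofReal m) :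
    volume S ≤ ENNReal.ofReal ((1 / ρ + 1) * m) := by
  refine measure_le_of_subset_biUnion (X := (Finset.range (⌊1 / ρ⌋₊ + 1) : Set ℕ))
    (Finset.finite_toSet _) (U := fun i => S ∩ Set.Icc (α + i * ρ) (α + (i + 1) * ρ)) hm ?_ ?_ ?_
  · rw [Set.ncard_coe_finset, Finset.card_range]
    push_cast
    gcongr
    exact Nat.floor_le (by positivity)
  · intro x hx
    obtain ⟨h1, h2⟩ := hS hx
    have h0 : 0 ≤ (x - α) / ρ := div_nonneg (by linarith) hρ.le
    have h3 := Nat.floor_le h0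
    have h4 := Nat.lt_floor_add_one ((x - α) / ρ)
    rw [le_div_iff₀ hρ] at h3
    rw [div_lt_iff₀ hρ] at h4
    simp only [Set.mem_iUnion]
    refine ⟨⌊(x - α) / ρ⌋₊, ?_, hx, by linarith, by linarith⟩
    simp only [Finset.coe_range, Set.mem_Iio]
    exact Nat.lt_succ_of_le (Nat.floor_le_floor (by gcongr; linarith))
  · intro i _
    refine h _ Set.inter_subset_left fun x hx y hy => ?_
    obtain ⟨_, h1, h2⟩ := hx
    obtain ⟨_, h3, h4⟩ := hy
    rw [abs_le]
    constructor <;> linarith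

/-- Quantitative form, with a single constant `M`, of the assumption that `f` has derivative `f'` on
`J`, with `|f'|` bounded above and below and `f''` positive and bounded above and below. -/
structure IsConvexArc (f f' : ℝ → ℝ) (J : Set ℝ) (M : ℝ) : Prop where
  one_le : 1 ≤ M
  abs_deriv_le : ∀ x ∈ J, |f' x| ≤ M
  abs_sub_le : ∀ x ∈ J, ∀ y ∈ J, |x - y| ≤ M * |f x - f y|
  taylor_lower : ∀ x ∈ J, ∀ y ∈ J, (y - x) ^ 2 / (2 * M) ≤ f y - f x - f' x * (y - x)
  taylor_upper : ∀ x ∈ J, ∀ y ∈ J, f y - f x - f' x * (y - x) ≤ M * (y - x) ^ 2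
  deriv_lower : ∀ x ∈ J, ∀ y ∈ J, x ≤ y → (y - x) / M ≤ f' y - f' x
  deriv_upper : ∀ x ∈ J, ∀ y ∈ J, x ≤ y → f' y - f' x ≤ M * (y - x)

namespace IsConvexArc

variable {f f' : ℝ → ℝ} {J : Set ℝ} {M : ℝ}

theorem pos (h : IsConvexArc f f' J M) : 0 < M := zero_lt_one.trans_le h.one_le

theorem abs_taylor_le (h : IsConvexArc f f' J M) {x y : ℝ} (hx : x ∈ J) (hy : y ∈ J) :
    |f y - f x - f' x * (y - x)| ≤ M * (y - x) ^ 2 := by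
  have hM := h.pos
  rw [abs_of_nonneg (le_trans (by positivity) (h.taylor_lower x hx y hy))]
  exact h.taylor_upper x hx y hy

theorem abs_deriv_sub_le (h : IsConvexArc f f' J M) {x y : ℝ} (hx : x ∈ J) (hy : y ∈ J) :
    |f' x - f' y| ≤ M * |x - y| := by
  have hM := h.pos
  rcases le_total x y with hxy | hxy
  · have h1 := h.deriv_lower x hx y hy hxy
    have h2 := h.deriv_upper x hx y hy hxy
    have h3 : 0 ≤ (y - x) / M := div_nonneg (by linarith) hM.le
    rw [abs_sub_comm, abs_sub_comm x y, abs_of_nonneg (sub_nonneg.2 hxy), abs_of_nonneg (by linarith)]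
    exact h2
  · have h1 := h.deriv_lower y hy x hx hxy
    have h2 := h.deriv_upper y hy x hx hxy
    have h3 : 0 ≤ (x - y) / M := div_nonneg (by linarith) hM.le
    rw [abs_of_nonneg (sub_nonneg.2 hxy), abs_of_nonneg (by linarith)]
    exact h2

theorem sub_le_of_abs_deriv_sub_le (h : IsConvexArc f f' J M) {x y σ d : ℝ} (hx : x ∈ J)
    (hy : y ∈ J) (hxy : x ≤ y) (hxσ : |f' x - σ| ≤ d) (hyσ : |f' y - σ| ≤ d) :
    y - x ≤ 2 * M * d := by
  have h1 := h.deriv_lower x hx y hy hxy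
  rw [div_le_iff₀ h.pos] at h1
  have h2 := abs_le.1 hxσ
  have h3 := abs_le.1 hyσ
  have h4 : (f' y - f' x) * M ≤ (2 * d) * M := mul_le_mul_of_nonneg_right (by linarith) h.pos.le
  linarith

end IsConvexArc

/-- `q` times the vertical distance from the point `(p / q, r / q)` to the tangent of the graph of
`f` at `x`. -/
def tangentDefect (f f' : ℝ → ℝ) (q p r x : ℝ) : ℝ := r - q * f x - f' x * (p - q * x)

namespace IsConvexArc

variable {f f' : ℝ → ℝ} {J : Set ℝ} {M : ℝ}

theorem le_tangentDefect_sub (h : IsConvexArc f f' J M) {q p r x y : ℝ} (hx : x ∈ J) (hy : y ∈ J)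
    (hxy : x ≤ y) (hq : 0 ≤ q) (hp : 0 ≤ p - q * y) :
    (y - x) * ((p - q * x) + (p - q * y)) / (2 * M) ≤
      tangentDefect f f' q p r x - tangentDefect f f' q p r y := by
  have hM := h.pos
  have h1 := mul_le_mul_of_nonneg_left (h.taylor_lower x hx y hy) hq
  have h2 := mul_le_mul_of_nonneg_right (h.deriv_lower x hx y hy hxy) hp
  have h3 : (y - x) * ((p - q * x) + (p - q * y)) / (2 * M) =
      q * ((y - x) ^ 2 / (2 * M)) + (y - x) / M * (p - q * y) := by
    field_simp
    ring
  rw [h3]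
  refine (add_le_add h1 h2).trans (le_of_eq ?_)
  simp only [tangentDefect]
  ring

theorem le_tangentDefect_sub' (h : IsConvexArc f f' J M) {q p r x y : ℝ} (hx : x ∈ J) (hy : y ∈ J)
    (hxy : x ≤ y) (hq : 0 ≤ q) (hp : p - q * x ≤ 0) :
    (y - x) * (-(p - q * x) - (p - q * y)) / (2 * M) ≤
      tangentDefect f f' q p r y - tangentDefect f f' q p r x := by
  have hM := h.pos
  have h1 := mul_le_mul_of_nonneg_left (h.taylor_lower y hy x hx) hq
  have h2 := mul_le_mul_of_nonneg_right (h.deriv_lower x hx y hy hxy) (neg_nonneg.2 hp)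
  have h3 : (y - x) * (-(p - q * x) - (p - q * y)) / (2 * M) =
      q * ((x - y) ^ 2 / (2 * M)) + (y - x) / M * -(p - q * x) := by
    field_simp
    ring
  rw [h3]
  refine (add_le_add h1 h2).trans (le_of_eq ?_)
  simp only [tangentDefect]
  ring

/-- The points of the arc whose tangent passes close to the point `(p / q, r / q)`. -/
theorem volume_tangentDefect_le (h : IsConvexArc f f' J M) {q p r A ε κ : ℝ} (hq : 0 < q)
    (hA : 0 < A) (hε : 0 < ε) (hκ : 0 < κ) :
    volume {x | x ∈ J ∧ A * |tangentDefect f f' q p r x| ≤ q * ε + |p - q * x| * κ} ≤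
      ENNReal.ofReal (2 * (4 * M * κ / A + 2 * ε / κ)) := by
  have hM := h.pos
  have key : ∀ x y s : ℝ, 0 ≤ s → (y - x) * q ≤ s →
      (y - x) * s / (2 * M) ≤
        |tangentDefect f f' q p r x| + |tangentDefect f f' q p r y| →
      A * (|tangentDefect f f' q p r x| + |tangentDefect f f' q p r y|) ≤ 2 * q * ε + s * κ →
      y - x ≤ 4 * M * κ / A + 2 * ε / κ := by
    intro x y s hs hsq h1 h2
    have e1 : 0 ≤ 4 * M * κ / A := by positivity
    have e2 : 0 ≤ 2 * ε / κ := by positivity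
    rcases le_or_gt (2 * q * ε) (s * κ) with h3 | h3
    · suffices y - x ≤ 4 * M * κ / A by linarith
      rw [le_div_iff₀ hA]
      rw [div_le_iff₀ (by positivity)] at h1
      have hs' : 0 < s := by
        by_contra h4
        have : s = 0 := le_antisymm (not_lt.1 h4) hs
        rw [this] at h3
        have : 0 < 2 * q * ε := by positivity
        linarith
      have h5 : ((y - x) * A) * s ≤ (4 * M * κ) * s := by
        calc ((y - x) * A) * s = A * ((y - x) * s) := by ring
          _ ≤ A * ((|tangentDefect f f' q p r x| + |tangentDefect f f' q p r y|) * (2 * M)) := by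
            gcongr
          _ = (A * (|tangentDefect f f' q p r x| + |tangentDefect f f' q p r y|)) * (2 * M) := by ring
          _ ≤ (2 * (s * κ)) * (2 * M) :=
            mul_le_mul_of_nonneg_right (by linarith) (by positivity)
          _ = _ := by ring
      exact le_of_mul_le_mul_right h5 hs'
    · suffices y - x ≤ 2 * ε / κ by linarith
      rw [le_div_iff₀ hκ]
      have h5 : ((y - x) * κ) * q ≤ (2 * ε) * q := by
        calc ((y - x) * κ) * q = ((y - x) * q) * κ := by ring
          _ ≤ s * κ := by gcongr
          _ ≤ _ := by linarith
      exact le_of_mul_le_mul_right h5 hq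
  have hcover : {x | x ∈ J ∧ A * |tangentDefect f f' q p r x| ≤ q * ε + |p - q * x| * κ} ⊆
      {x | (x ∈ J ∧ A * |tangentDefect f f' q p r x| ≤ q * ε + |p - q * x| * κ) ∧ 0 ≤ p - q * x} ∪
      {x | (x ∈ J ∧ A * |tangentDefect f f' q p r x| ≤ q * ε + |p - q * x| * κ) ∧ p - q * x ≤ 0} := by
    intro x hx
    rcases le_total 0 (p - q * x) with h0 | h0
    · exact Or.inl ⟨hx, h0⟩
    · exact Or.inr ⟨hx, h0⟩
  refine (measure_mono hcover).trans ((measure_union_le _ _).trans ?_)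
  rw [two_mul, ENNReal.ofReal_add (by positivity) (by positivity)]
  refine add_le_add (volume_le_of_pairwise_sub_le ?_) (volume_le_of_pairwise_sub_le ?_)
  · rintro x ⟨⟨hx, hx1⟩, hx0⟩ y ⟨⟨hy, hy1⟩, hy0⟩ hxy
    rw [abs_of_nonneg hx0] at hx1
    rw [abs_of_nonneg hy0] at hy1
    refine key x y ((p - q * x) + (p - q * y)) (by linarith) (by nlinarith) ?_ (by linarith)
    refine (h.le_tangentDefect_sub (r := r) hx hy hxy hq.le hy0).trans ?_
    linarith [le_abs_self (tangentDefect f f' q p r x), neg_abs_le (tangentDefect f f' q p r y)]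
  · rintro x ⟨⟨hx, hx1⟩, hx0⟩ y ⟨⟨hy, hy1⟩, hy0⟩ hxy
    rw [abs_of_nonpos hx0] at hx1
    rw [abs_of_nonpos hy0] at hy1
    refine key x y (-(p - q * x) - (p - q * y)) (by linarith) (by nlinarith) ?_ (by linarith)
    refine (h.le_tangentDefect_sub' (r := r) hx hy hxy hq.le hx0).trans ?_
    linarith [le_abs_self (tangentDefect f f' q p r y), neg_abs_le (tangentDefect f f' q p r x)]

theorem volume_exists_tangentDefect_le (h : IsConvexArc f f' J M) {α : ℝ}
    (hJ : J ⊆ Set.Icc α (α + 1)) {A ε κ R : ℝ} (hA : 0 < A) (hε : 0 < ε) (hκ : 0 < κ) (hR : 0 ≤ R) :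
    volume {x | x ∈ J ∧ ∃ (q : ℕ) (p r : ℤ), 1 ≤ q ∧ (q : ℝ) ≤ R ∧ |p - q * x| ≤ 1 ∧
      |tangentDefect f f' q p r x| ≤ 1 ∧
      A * |tangentDefect f f' q p r x| ≤ q * ε + |p - q * x| * κ} ≤
      ENNReal.ofReal (R * (8 * R * (18 * M * (2 * (4 * M * κ / A + 2 * ε / κ))))) := by
  have hM := h.pos
  have hM1 := h.one_le
  set m := 2 * (4 * M * κ / A + 2 * ε / κ) with hm
  have hm0 : 0 ≤ m := by positivity
  let W : ℕ → ℤ → ℤ → Set ℝ := fun q p r => {x | x ∈ J ∧ |p - q * x| ≤ 1 ∧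
    |tangentDefect f f' q p r x| ≤ 1 ∧
    A * |tangentDefect f f' q p r x| ≤ q * ε + |p - q * x| * κ}
  have hWm : ∀ q : ℕ, 1 ≤ q → ∀ p r : ℤ, volume (W q p r) ≤ ENNReal.ofReal m := by
    intro q hq p r
    refine (measure_mono ?_).trans (h.volume_tangentDefect_le (q := q) (p := p) (r := r)
      (by exact_mod_cast hq) hA hε hκ)
    rintro x ⟨h1, _, _, h2⟩
    exact ⟨h1, h2⟩
  have hr : ∀ q : ℕ, 1 ≤ q → ∀ p : ℤ, volume (⋃ r, W q p r) ≤ ENNReal.ofReal (18 * M * m) := by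
    intro q hq p
    have hq' : (1 : ℝ) ≤ q := by exact_mod_cast hq
    obtain ⟨h1, h2⟩ := finite_ncard_le_of_separated {r : ℤ | (W q p r).Nonempty} (fun r => (r : ℝ))
      one_pos (W := 2 + 6 * M) (by positivity) (by
        intro i _ j _ hij
        have : 1 ≤ |i - j| := Int.one_le_abs (sub_ne_zero.2 hij)
        exact_mod_cast this) (by
        rintro i ⟨x, hx, hx1, hx2, -⟩ j ⟨y, hy, hy1, hy2, -⟩
        have hxy : q * |x - y| ≤ 2 := by
          rw [← abs_of_nonneg (Nat.cast_nonneg (α := ℝ) q), ← abs_mul]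
          have e : (q : ℝ) * (x - y) = (p - q * y) - (p - q * x) := by ring
          rw [e]
          refine (abs_sub _ _).trans ?_
          linarith
        have hxy' : |x - y| ≤ 2 := le_trans (by nlinarith [abs_nonneg (x - y)]) hxy
        have e : (i : ℝ) - j = tangentDefect f f' q p i x - tangentDefect f f' q p j y
            - q * (f y - f x - f' x * (y - x)) + (f' x - f' y) * (p - q * y) := by
          simp only [tangentDefect]
          ring
        have e1 : |(q : ℝ) * (f y - f x - f' x * (y - x))| ≤ 4 * M := by
          rw [abs_mul, abs_of_nonneg (Nat.cast_nonneg (α := ℝ) q)]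
          calc (q : ℝ) * |f y - f x - f' x * (y - x)| ≤ q * (M * (y - x) ^ 2) := by
                gcongr
                exact h.abs_taylor_le hx hy
            _ = (q * |x - y|) * |x - y| * M := by rw [← sq_abs, abs_sub_comm]; ring
            _ ≤ 2 * 2 * M := by gcongr
            _ = 4 * M := by ring
        have e2 : |(f' x - f' y) * (p - q * y)| ≤ 2 * M := by
          rw [abs_mul]
          calc |f' x - f' y| * |p - q * y| ≤ (M * 2) * 1 := by
                gcongr
                exact (h.abs_deriv_sub_le hx hy).trans (by gcongr)
            _ = 2 * M := by ring
        rw [e]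
        rw [abs_le] at *
        constructor <;> linarith)
    refine measure_le_of_subset_biUnion h1 (U := fun r => W q p r) hm0 ?_ ?_ fun r _ => hWm q hq p r
    · refine h2.trans ?_
      linarith
    · intro x hx
      obtain ⟨r, hr⟩ := Set.mem_iUnion.1 hx
      exact Set.mem_biUnion (x := r) ⟨x, hr⟩ hr
  have hp : ∀ q : ℕ, 1 ≤ q → (q : ℝ) ≤ R →
      volume (⋃ p, ⋃ r, W q p r) ≤ ENNReal.ofReal (8 * R * (18 * M * m)) := by
    intro q hq hqR
    have hq' : (1 : ℝ) ≤ q := by exact_mod_cast hq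
    obtain ⟨h1, h2⟩ := finite_ncard_le_of_separated {p : ℤ | (⋃ r, W q p r).Nonempty}
      (fun p => (p : ℝ)) one_pos (W := q + 2) (by positivity) (by
        intro i _ j _ hij
        have : 1 ≤ |i - j| := Int.one_le_abs (sub_ne_zero.2 hij)
        exact_mod_cast this) (by
        rintro i ⟨x, hx⟩ j ⟨y, hy⟩
        obtain ⟨r, hx, hx1, -⟩ := Set.mem_iUnion.1 hx
        obtain ⟨s, hy, hy1, -⟩ := Set.mem_iUnion.1 hy
        have e : (i : ℝ) - j = (i - q * x) - (j - q * y) + q * (x - y) := by ring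
        have e1 : |(q : ℝ) * (x - y)| ≤ q := by
          rw [abs_mul, abs_of_nonneg (Nat.cast_nonneg (α := ℝ) q)]
          have : |x - y| ≤ 1 := by
            have := hJ hx
            have := hJ hy
            simp only [Set.mem_Icc] at *
            rw [abs_le]
            constructor <;> linarith
          nlinarith
        rw [e]
        rw [abs_le] at *
        constructor <;> linarith)
    refine measure_le_of_subset_biUnion h1 (U := fun p => ⋃ r, W q p r) (by positivity) ?_ ?_
      fun p _ => hr q hq p
    · refine h2.trans ?_
      linarith
    · intro x hx
      obtain ⟨p, hp⟩ := Set.mem_iUnion.1 hx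
      exact Set.mem_biUnion (x := p) ⟨x, hp⟩ hp
  refine measure_le_of_subset_biUnion (X := (Finset.Icc 1 ⌊R⌋₊ : Set ℕ)) (Finset.finite_toSet _)
    (U := fun q => ⋃ p, ⋃ r, W q p r) (by positivity) ?_ ?_ ?_
  · rw [Set.ncard_coe_finset, Nat.card_Icc]
    simpa using Nat.floor_le hR
  · rintro x ⟨hx, q, p, r, h1, h2, h3⟩
    refine Set.mem_biUnion (x := q) ?_ ?_
    · simpa using ⟨h1, Nat.le_floor h2⟩
    · simp only [Set.mem_iUnion]
      exact ⟨p, r, hx, h3⟩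
  · intro q hq
    simp only [Finset.coe_Icc, Set.mem_Icc] at hq
    exact hp q hq.1 ((Nat.le_floor_iff hR).1 hq.2)

end IsConvexArc

/-- The integer line `a + b x + c y = 0` is almost tangent to the graph of `f` at `x`. -/
structure IsAlmostTangent (f f' : ℝ → ℝ) (ε κ : ℝ) (a b c : ℤ) (x : ℝ) : Prop where
  abs_le : |a + b * x + c * f x| ≤ ε
  abs_deriv_le : |b + c * f' x| ≤ κ

namespace IsConvexArc

variable {f f' : ℝ → ℝ} {J : Set ℝ} {M : ℝ}

theorem volume_isAlmostTangent_short_le (h : IsConvexArc f f' J M) {A ε κ R : ℝ} (hA : 1 ≤ A)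
    (hε : 144 * M * A * ε ≤ 1) (hκ0 : 0 < κ) (hκ : κ ≤ 1 / 12) (hR : 0 < R) {T : Set ℝ}
    (hT : ∀ x ∈ T, x ∈ J ∧
      ∃ a b c : ℤ, A ≤ c ∧ c < 2 * A ∧ IsAlmostTangent f f' ε κ a b c x)
    (hTW : ∀ x ∈ T, ¬ ∃ (q : ℕ) (p r : ℤ), 1 ≤ q ∧ (q : ℝ) ≤ R ∧ |p - q * x| ≤ 1 ∧
      |tangentDefect f f' q p r x| ≤ 1 ∧
      A * |tangentDefect f f' q p r x| ≤ q * ε + |p - q * x| * κ)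
    (hTd : ∀ x ∈ T, ∀ y ∈ T, |x - y| ≤ 1 / (12 * M * A)) :
    volume T ≤ ENNReal.ofReal ((2 + 2 * A / R) * (2 * M * (κ / A))) := by
  have hM := h.pos
  have hM1 := h.one_le
  have hA0 : 0 < A := by linarith
  let V : ℤ → ℤ → ℤ → Prop := fun a b c => A ≤ c ∧ c < 2 * A ∧
    ∃ x ∈ T, IsAlmostTangent f f' ε κ a b c x
  let X : Set ℝ := {σ | ∃ a b c : ℤ, V a b c ∧ σ = -(b / c : ℝ)}
  have hslope : ∀ a b c : ℤ, A ≤ c → ∀ x, IsAlmostTangent f f' ε κ a b c x →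
      |f' x - -(b / c : ℝ)| ≤ κ / A := by
    intro a b c hc x hx
    have hc0 : (0 : ℝ) < c := by linarith
    have e : f' x - -(b / c : ℝ) = (b + c * f' x) / c := by field_simp; ring
    rw [e, abs_div, abs_of_pos hc0]
    exact div_le_div₀ hκ0.le hx.abs_deriv_le hA0 hc
  suffices hX : X.Finite ∧ (X.ncard : ℝ) ≤ 2 + 2 * A / R by
    refine measure_le_of_subset_biUnion hX.1 (U := fun σ => {x | x ∈ J ∧ |f' x - σ| ≤ κ / A})
      (by positivity) hX.2 ?_ ?_
    · intro x hx
      obtain ⟨hxJ, a, b, c, h1, h2, h3⟩ := hT x hx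
      exact Set.mem_biUnion (x := -(b / c : ℝ)) ⟨a, b, c, ⟨h1, h2, x, hx, h3⟩, rfl⟩
        ⟨hxJ, hslope a b c h1 x h3⟩
    · intro σ _
      refine volume_le_of_pairwise_sub_le ?_
      rintro x ⟨hx, hx1⟩ y ⟨hy, hy1⟩ hxy
      exact h.sub_le_of_abs_deriv_sub_le hx hy hxy hx1 hy1
  by_cases hpar : ∀ a b c a' b' c' : ℤ, V a b c → V a' b' c' → b * c' - c * b' = 0
  · have hsub : X.Subsingleton := by
      rintro σ ⟨a, b, c, hV, rfl⟩ τ ⟨a', b', c', hV', rfl⟩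
      have h1 : (b : ℝ) * c' - c * b' = 0 := by exact_mod_cast hpar a b c a' b' c' hV hV'
      have hc0 : (c : ℝ) ≠ 0 := by linarith [hV.1]
      have hc0' : (c' : ℝ) ≠ 0 := by linarith [hV'.1]
      rw [neg_inj, div_eq_div_iff hc0 hc0']
      linarith
    refine ⟨hsub.finite, ?_⟩
    have h1 : X.ncard ≤ 1 := (Set.ncard_le_one hsub.finite).2 fun a ha b hb => hsub ha hb
    have h2 : (X.ncard : ℝ) ≤ 1 := by exact_mod_cast h1
    have h3 : 0 ≤ 2 * A / R := by positivity
    linarith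
  classical
  have hex : ∃ n : ℕ, 0 < n ∧ ∃ a b c a' b' c' : ℤ, V a b c ∧ V a' b' c' ∧
      b * c' - c * b' = n := by
    push Not at hpar
    obtain ⟨a, b, c, a', b', c', hV, hV', hne⟩ := hpar
    rcases lt_or_gt_of_ne hne with h0 | h0
    · exact ⟨(b' * c - c' * b).toNat, by lia, a', b', c', a, b, c, hV', hV, by lia⟩
    · exact ⟨(b * c' - c * b').toNat, by lia, a, b, c, a', b', c', hV, hV', by lia⟩
  obtain ⟨hn0, a, b, c, a', b', c', hV, hV', hn⟩ := Nat.find_spec hex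
  have hmin := fun m => Nat.find_min' hex (m := m)
  set n := Nat.find hex
  have hn1 : (1 : ℝ) ≤ n := by exact_mod_cast hn0
  have hnR : (n : ℝ) = b * c' - c * b' := by exact_mod_cast hn.symm
  have hframe : ∀ a b c : ℤ, V a b c → ∀ x ∈ T, |(b : ℝ) + c * f' x| ≤ 1 / 4 ∧
      |(a : ℝ) + b * x + c * f x| ≤ 1 / (36 * M * A) ∧ |(c : ℝ)| ≤ 2 * A := by
    rintro a b c ⟨h1, h2, y, hy, hy1, hy2⟩ x hx
    have hc0 : (0 : ℝ) < c := by linarith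
    have hxy := hTd x hx y hy
    have hxJ := (hT x hx).1
    have hyJ := (hT y hy).1
    have e0 : |(c : ℝ)| ≤ 2 * A := by rw [abs_of_pos hc0]; exact h2.le
    refine ⟨?_, ?_, e0⟩
    · have e : (b : ℝ) + c * f' x = (b + c * f' y) + c * (f' x - f' y) := by ring
      have e1 : |(c : ℝ) * (f' x - f' y)| ≤ 1 / 6 := by
        rw [abs_mul]
        calc |(c : ℝ)| * |f' x - f' y| ≤ (2 * A) * (M * (1 / (12 * M * A))) := by
              gcongr
              exact (h.abs_deriv_sub_le hxJ hyJ).trans (by gcongr)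
          _ = 1 / 6 := by field_simp; norm_num
      rw [e]
      refine (abs_add_le _ _).trans ?_
      linarith
    · have e : (a : ℝ) + b * x + c * f x = (a + b * y + c * f y) + (b + c * f' y) * (x - y) +
          c * (f x - f y - f' y * (x - y)) := by ring
      have e1 : |((b : ℝ) + c * f' y) * (x - y)| ≤ 1 / (144 * M * A) := by
        rw [abs_mul]
        calc |(b : ℝ) + c * f' y| * |x - y| ≤ (1 / 12) * (1 / (12 * M * A)) := by
              gcongr
              linarith
          _ = _ := by field_simp; norm_num
      have e2 : |(c : ℝ) * (f x - f y - f' y * (x - y))| ≤ 2 / (144 * M * A) := by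
        rw [abs_mul]
        calc |(c : ℝ)| * |f x - f y - f' y * (x - y)| ≤
              (2 * A) * (M * (1 / (12 * M * A)) ^ 2) := by
              gcongr
              refine (h.abs_taylor_le hyJ hxJ).trans ?_
              rw [← sq_abs]
              gcongr
          _ = _ := by field_simp; norm_num
      have e3 : ε ≤ 1 / (144 * M * A) := by
        rw [le_div_iff₀ (by positivity)]
        linarith
      have e4 : 1 / (36 * M * A) = 1 / (144 * M * A) + 1 / (144 * M * A) + 2 / (144 * M * A) := by
        field_simp; norm_num
      rw [e, e4]
      refine (abs_add_le _ _).trans (add_le_add ((abs_add_le _ _).trans (add_le_add ?_ e1)) e2)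
      linarith
  have hMA : 1 / (36 * M * A) ≤ 1 / 36 := by
    apply one_div_le_one_div_of_le (by norm_num)
    nlinarith
  have hMA' : A * (1 / (36 * M * A)) ≤ 1 / 36 := by
    rw [mul_one_div, div_le_div_iff₀ (by positivity) (by norm_num)]
    nlinarith
  set d := 1 / (36 * M * A) with hd
  have hd0 : 0 ≤ d := by positivity
  have hdet2 : ∀ {s t u v p₁ p₂ : ℝ}, |s| ≤ p₁ → |t| ≤ p₁ → |u| ≤ p₂ → |v| ≤ p₂ →
      |s * v - t * u| ≤ 2 * (p₁ * p₂) := by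
    intro s t u v p₁ p₂ hs ht hu hv
    have hp₁ : 0 ≤ p₁ := (abs_nonneg s).trans hs
    refine (abs_sub _ _).trans ?_
    rw [abs_mul, abs_mul, two_mul]
    exact add_le_add (mul_le_mul hs hv (abs_nonneg _) hp₁) (mul_le_mul ht hu (abs_nonneg _) hp₁)
  have hpr : ∀ x ∈ T, |((c * a' - a * c' : ℤ) : ℝ) - n * x| ≤ 1 / 9 ∧
      |tangentDefect f f' n (c * a' - a * c' : ℤ) (a * b' - b * a' : ℤ) x| ≤ d / 2 ∧
      (n : ℝ) ≤ A := by
    intro x hx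
    obtain ⟨h1, h2, h3⟩ := hframe a b c hV x hx
    obtain ⟨h1', h2', h3'⟩ := hframe a' b' c' hV' x hx
    have e1 : ((c * a' - a * c' : ℤ) : ℝ) - n * x =
        c * (a' + b' * x + c' * f x) - c' * (a + b * x + c * f x) := by
      rw [hnR]; push_cast; ring
    have e2 : tangentDefect f f' n (c * a' - a * c' : ℤ) (a * b' - b * a' : ℤ) x =
        (a + b * x + c * f x) * (b' + c' * f' x) - (a' + b' * x + c' * f x) * (b + c * f' x) := by
      rw [tangentDefect, hnR]; push_cast; ring
    have e3 : (n : ℝ) = (b + c * f' x) * c' - (b' + c' * f' x) * c := by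
      rw [hnR]; ring
    refine ⟨?_, ?_, ?_⟩
    · rw [e1]
      refine (hdet2 h3 h3' h2 h2').trans ?_
      linarith
    · rw [e2]
      refine (hdet2 h2 h2' h1 h1').trans ?_
      linarith
    · have := (le_abs_self _).trans (hdet2 h1 h1' h3 h3')
      rw [← e3] at this
      linarith
  have hcoplanar : ∀ a'' b'' c'' : ℤ, V a'' b'' c'' →
      a'' * n + b'' * (c * a' - a * c') + c'' * (a * b' - b * a') = 0 := by
    rintro a'' b'' c'' hV''
    obtain ⟨_, _, x, hx, _⟩ := id hV''
    obtain ⟨h1, h2, h3⟩ := hframe a'' b'' c'' hV'' x hx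
    obtain ⟨g1, g2, g3⟩ := hpr x hx
    have hlt : |((a'' * n + b'' * (c * a' - a * c') + c'' * (a * b' - b * a') : ℤ) : ℝ)| < 1 := by
      have e : ((a'' * n + b'' * (c * a' - a * c') + c'' * (a * b' - b * a') : ℤ) : ℝ) =
          n * (a'' + b'' * x + c'' * f x) +
          (((c * a' - a * c' : ℤ) : ℝ) - n * x) * (b'' + c'' * f' x) +
          c'' * tangentDefect f f' n (c * a' - a * c' : ℤ) (a * b' - b * a' : ℤ) x := by
        rw [tangentDefect]; push_cast; ring
      have k1 : |(n : ℝ) * (a'' + b'' * x + c'' * f x)| ≤ A * d := by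
        rw [abs_mul, abs_of_nonneg (Nat.cast_nonneg (α := ℝ) n)]
        gcongr
      have k2 : |(((c * a' - a * c' : ℤ) : ℝ) - n * x) * (b'' + c'' * f' x)| ≤ 1 / 9 * (1 / 4) := by
        rw [abs_mul]
        gcongr
      have k3 : |c'' * tangentDefect f f' n (c * a' - a * c' : ℤ) (a * b' - b * a' : ℤ) x| ≤
          2 * A * (d / 2) := by
        rw [abs_mul]
        gcongr
      rw [e]
      refine (abs_add_le _ _).trans_lt ?_
      have := abs_add_le ((n : ℝ) * (a'' + b'' * x + c'' * f x))
        ((((c * a' - a * c' : ℤ) : ℝ) - n * x) * (b'' + c'' * f' x))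
      linarith
    have : |a'' * n + b'' * (c * a' - a * c') + c'' * (a * b' - b * a')| < 1 := by
      exact_mod_cast hlt
    exact Int.abs_lt_one_iff.1 this
  have hRn : R < n := by
    by_contra hle
    obtain ⟨h1, h2, x, hx, -⟩ := id hV
    obtain ⟨g1, g2, g3⟩ := hpr x hx
    refine hTW x hx ⟨n, c * a' - a * c', a * b' - b * a', hn0, not_lt.1 hle, by linarith,
      by linarith, ?_⟩
    obtain ⟨-, a'', b'', c'', k1, k2, k3⟩ := hT x hx
    have k0 : ((a'' * n + b'' * (c * a' - a * c') + c'' * (a * b' - b * a') : ℤ) : ℝ) = 0 := by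
      exact_mod_cast hcoplanar a'' b'' c'' ⟨k1, k2, x, hx, k3⟩
    have e : c'' * tangentDefect f f' n (c * a' - a * c' : ℤ) (a * b' - b * a' : ℤ) x =
        - (n * (a'' + b'' * x + c'' * f x)) -
        (((c * a' - a * c' : ℤ) : ℝ) - n * x) * (b'' + c'' * f' x) := by
      rw [← sub_eq_zero, ← k0, tangentDefect]; push_cast; ring
    calc A * |tangentDefect f f' n (c * a' - a * c' : ℤ) (a * b' - b * a' : ℤ) x| ≤
        |(c'' : ℝ)| * |tangentDefect f f' n (c * a' - a * c' : ℤ) (a * b' - b * a' : ℤ) x| := by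
          gcongr
          exact k1.trans (le_abs_self _)
      _ ≤ _ := by
          rw [← abs_mul, e]
          refine (abs_sub _ _).trans ?_
          rw [abs_neg, abs_mul, abs_mul, abs_of_nonneg (Nat.cast_nonneg (α := ℝ) n)]
          have := k3.abs_le
          have := k3.abs_deriv_le
          gcongr
  obtain ⟨r1, r2⟩ := finite_ncard_le_of_separated X id (d := n / (4 * A ^ 2)) (W := 1 / (4 * A))
    (by positivity) (by positivity) (by
      rintro σ ⟨a, b, c, hV, rfl⟩ τ ⟨a', b', c', hV', rfl⟩ hne
      have hc0 : (0 : ℝ) < c := by linarith [hV.1]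
      have hc0' : (0 : ℝ) < c' := by linarith [hV'.1]
      have hne' : b * c' - c * b' ≠ 0 := by
        intro h0
        have h1 : (b : ℝ) * c' - c * b' = 0 := by exact_mod_cast h0
        refine hne ?_
        rw [neg_inj, div_eq_div_iff hc0.ne' hc0'.ne']
        linarith
      have hle : (n : ℤ) ≤ |b * c' - c * b'| := by
        rcases lt_or_gt_of_ne hne' with h0 | h0
        · have := hmin (b' * c - c' * b).toNat ⟨by lia, a', b', c', a, b, c, hV', hV, by lia⟩
          rw [abs_of_neg h0]
          lia
        · have := hmin (b * c' - c * b').toNat ⟨by lia, a, b, c, a', b', c', hV, hV', by lia⟩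
          rw [abs_of_pos h0]
          lia
      have hle' : (n : ℝ) ≤ |(b : ℝ) * c' - c * b'| := by exact_mod_cast hle
      have e : id (-(b / c : ℝ)) - id (-(b' / c' : ℝ)) = -((b * c' - c * b') / (c * c')) := by
        simp only [id]; field_simp; ring
      rw [e, abs_neg, abs_div, abs_of_pos (mul_pos hc0 hc0')]
      refine div_le_div₀ (abs_nonneg _) hle' (mul_pos hc0 hc0') ?_
      nlinarith [hV.2.1, hV'.2.1]) (by
      rintro σ ⟨a, b, c, hV, rfl⟩ τ ⟨a', b', c', hV', rfl⟩
      obtain ⟨h1, h2, x, hx, hx'⟩ := hV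
      obtain ⟨h1', h2', y, hy, hy'⟩ := hV'
      have e1 := hslope a b c h1 x hx'
      have e2 := hslope a' b' c' h1' y hy'
      have e3 : |f' x - f' y| ≤ 1 / (12 * A) := by
        refine (h.abs_deriv_sub_le (hT x hx).1 (hT y hy).1).trans ?_
        calc M * |x - y| ≤ M * (1 / (12 * M * A)) := by gcongr; exact hTd x hx y hy
          _ = _ := by field_simp
      have e4 : κ / A ≤ 1 / (12 * A) := by
        rw [div_le_div_iff₀ hA0 (by positivity)]
        nlinarith
      have e5 : 1 / (4 * A) = 1 / (12 * A) + 1 / (12 * A) + 1 / (12 * A) := by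
        field_simp; norm_num
      simp only [id]
      rw [e5]
      rw [abs_le] at *
      constructor <;> linarith)
  refine ⟨r1, r2.trans ?_⟩
  have e : 2 * (1 / (4 * A)) / (n / (4 * A ^ 2)) = 2 * A / n := by field_simp
  rw [e]
  gcongr

theorem volume_isAlmostTangent_le (h : IsConvexArc f f' J M) {α : ℝ}
    (hJ : J ⊆ Set.Icc α (α + 1)) {A ε κ R : ℝ} (hA : 1 ≤ A) (hε0 : 0 < ε)
    (hε : 144 * M * A * ε ≤ 1) (hκ0 : 0 < κ) (hκ : κ ≤ 1 / 12) (hR : 0 < R) :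
    volume {x | x ∈ J ∧ ∃ a b c : ℤ, A ≤ c ∧ c < 2 * A ∧ IsAlmostTangent f f' ε κ a b c x} ≤
      ENNReal.ofReal (R * (8 * R * (18 * M * (2 * (4 * M * κ / A + 2 * ε / κ)))) +
        (12 * M * A + 1) * ((2 + 2 * A / R) * (2 * M * (κ / A)))) := by
  have hM := h.pos
  rw [ENNReal.ofReal_add (by positivity) (by positivity)]
  refine (measure_mono (Set.subset_union_right.trans Set.union_sdiff_self.symm.subset)).trans
    ((measure_union_le _ _).trans (add_le_add
      (h.volume_exists_tangentDefect_le hJ (by linarith : 0 < A) hε0 hκ0 hR.le) ?_))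
  have e : 12 * M * A = 1 / (1 / (12 * M * A)) := by rw [one_div_one_div]
  rw [e]
  refine volume_le_of_short_pieces (by positivity) (by positivity)
    (fun x hx => hJ hx.1.1) fun T hT hTd => ?_
  exact h.volume_isAlmostTangent_short_le hA hε hκ0 hκ hR (fun x hx => (hT hx).1)
    (fun x hx hW => (hT hx).2 ⟨(hT hx).1.1, hW⟩) hTd

end IsConvexArc

/-- `(p / q, r / q)` is a rational point of height about `Q` close to `(x, f x)`. -/
structure IsNearRational (f : ℝ → ℝ) (Q δ₁ δ₂ : ℝ) (q p r : ℤ) (x : ℝ) : Prop where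
  le : Q ≤ q
  lt : q < 2 * Q
  abs_fst_le : |p - q * x| ≤ δ₁
  abs_snd_le : |r - q * f x| ≤ δ₂

namespace IsConvexArc

variable {f f' : ℝ → ℝ} {J : Set ℝ} {M : ℝ}

theorem frame_of_isNearRational (h : IsConvexArc f f' J M) {Q L δ₁ δ₂ : ℝ} (hQ : 0 < Q)
    (hL : 0 < L) (hL1 : L ≤ 1) (h1 : δ₁ ≤ Q * L ^ 2) (h2 : δ₂ ≤ Q * L ^ 2) {q p r : ℤ} {x y : ℝ}
    (hx : x ∈ J) (hy : y ∈ J) (hxy : |x - y| ≤ L) (hV : IsNearRational f Q δ₁ δ₂ q p r y) :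
    |(p : ℝ) - q * x| ≤ 3 * (Q * L) ∧ |tangentDefect f f' q p r x| ≤ 4 * M * (Q * L ^ 2) := by
  have hM1 := h.one_le
  have hq : (0 : ℝ) < q := hQ.trans_le hV.le
  have hq2 := hV.lt.le
  constructor
  · have e : (p : ℝ) - q * x = (p - q * y) - q * (x - y) := by ring
    have e1 : |(q : ℝ) * (x - y)| ≤ 2 * Q * L := by
      rw [abs_mul, abs_of_pos hq]
      gcongr
    have e2 : Q * L ^ 2 ≤ Q * L := by
      gcongr
      nlinarith
    rw [e]
    refine (abs_sub _ _).trans ?_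
    linarith [hV.abs_fst_le]
  · have e : tangentDefect f f' q p r x = (r - q * f y) - f' x * (p - q * y) +
        q * (f y - f x - f' x * (y - x)) := by
      rw [tangentDefect]; ring
    have e1 : |f' x * (p - q * y)| ≤ M * (Q * L ^ 2) := by
      rw [abs_mul]
      have := h.abs_deriv_le x hx
      have := hV.abs_fst_le.trans h1
      gcongr
    have e2 : |(q : ℝ) * (f y - f x - f' x * (y - x))| ≤ 2 * M * (Q * L ^ 2) := by
      rw [abs_mul, abs_of_pos hq]
      calc (q : ℝ) * |f y - f x - f' x * (y - x)| ≤ (2 * Q) * (M * L ^ 2) := by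
            gcongr
            refine (h.abs_taylor_le hx hy).trans ?_
            rw [← sq_abs, abs_sub_comm]
            have := h.pos
            gcongr
        _ = _ := by ring
    have e3 : Q * L ^ 2 ≤ M * (Q * L ^ 2) := le_mul_of_one_le_left (by positivity) hM1
    rw [e]
    have g1 := abs_add_le ((r : ℝ) - q * f y - f' x * (p - q * y))
      (q * (f y - f x - f' x * (y - x)))
    have g2 := abs_sub ((r : ℝ) - q * f y) (f' x * (p - q * y))
    linarith [hV.abs_snd_le]

theorem volume_isNearRational_short_le (h : IsConvexArc f f' J M) {Q L δ₁ δ₂ : ℝ} (hQ : 0 < Q)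
    (hL : 0 < L) (hQL : 1 ≤ Q * L) (hδ : Q * L ^ 2 ≤ 1) (h1 : δ₁ ≤ Q * L ^ 2)
    (h2 : δ₂ ≤ Q * L ^ 2) (hδ₁ : 0 ≤ δ₁) (hδ₂ : 0 ≤ δ₂) {T : Set ℝ}
    (hT : ∀ x ∈ T, x ∈ J ∧ ∃ q p r : ℤ, IsNearRational f Q δ₁ δ₂ q p r x)
    (hTZ : ∀ x ∈ T, ¬ ∃ a b c : ℤ, 1 ≤ c ∧ c * (Q * L ^ 2) ≤ 1 ∧
      IsAlmostTangent f f' (28 * M / Q) (8 * M / (Q * L)) a b c x)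
    (hTd : ∀ x ∈ T, ∀ y ∈ T, |x - y| ≤ L) :
    volume T ≤ ENNReal.ofReal (3888 * M * (Q * L) ^ 3 * (2 * M * min δ₁ δ₂ / Q)) := by
  have hM := h.pos
  have hM1 := h.one_le
  have hL1 : L ≤ 1 := by nlinarith
  obtain rfl | ⟨x₀, hx₀⟩ := T.eq_empty_or_nonempty
  · simp
  let V : ℤ → ℤ → ℤ → Prop := fun q p r => ∃ x ∈ T, IsNearRational f Q δ₁ δ₂ q p r x
  let X : Set (ℝ × ℝ) := {P | ∃ q p r : ℤ, V q p r ∧ P = ((p / q : ℝ), (r / q : ℝ))}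
  have hVq : ∀ q p r : ℤ, V q p r → Q ≤ q ∧ (0 : ℝ) < q ∧ q < 2 * Q := by
    rintro q p r ⟨x, _, hx⟩
    exact ⟨hx.le, hQ.trans_le hx.le, hx.lt⟩
  suffices hX : X.Finite ∧ (X.ncard : ℝ) ≤ 3888 * M * (Q * L) ^ 3 by
    refine measure_le_of_subset_biUnion hX.1
      (U := fun P => {x | x ∈ J ∧ |P.1 - x| ≤ δ₁ / Q ∧ |P.2 - f x| ≤ δ₂ / Q})
      (by positivity) hX.2 ?_ ?_
    · intro x hx
      obtain ⟨hxJ, q, p, r, hV⟩ := hT x hx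
      obtain ⟨g1, g2, g3⟩ := hVq q p r ⟨x, hx, hV⟩
      refine Set.mem_biUnion (x := ((p / q : ℝ), (r / q : ℝ))) ⟨q, p, r, ⟨x, hx, hV⟩, rfl⟩
        ⟨hxJ, ?_, ?_⟩
      · have e : (p / q : ℝ) - x = (p - q * x) / q := by field_simp
        rw [e, abs_div, abs_of_pos g2]
        exact div_le_div₀ hδ₁ hV.abs_fst_le hQ g1
      · have e : (r / q : ℝ) - f x = (r - q * f x) / q := by field_simp
        rw [e, abs_div, abs_of_pos g2]
        exact div_le_div₀ hδ₂ hV.abs_snd_le hQ g1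
    · rintro ⟨P₁, P₂⟩ _
      refine volume_le_of_pairwise_sub_le ?_
      rintro x ⟨hx, hx1, hx2⟩ y ⟨hy, hy1, hy2⟩ hxy
      simp only at hx1 hx2 hy1 hy2
      have e0 := abs_sub_comm x y ▸ h.abs_sub_le x hx y hy
      have e1 : |f x - f y| ≤ 2 * (δ₂ / Q) := by
        rw [abs_le] at *
        constructor <;> linarith
      have e2 : y - x ≤ 2 * (δ₁ / Q) := by
        rw [abs_le] at *
        linarith
      have e3 : y - x ≤ M * (2 * (δ₂ / Q)) := (le_abs_self _).trans (e0.trans (by gcongr))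
      have e4 : y - x ≤ M * (2 * (δ₁ / Q)) :=
        e2.trans (le_mul_of_one_le_left (by positivity) hM1)
      rcases min_choice δ₁ δ₂ with e | e <;> rw [e]
      · exact e4.trans_eq (by ring)
      · exact e3.trans_eq (by ring)
  have hframe : ∀ q p r : ℤ, V q p r → ∀ x ∈ T, |(p : ℝ) - q * x| ≤ 3 * (Q * L) ∧
      |tangentDefect f f' q p r x| ≤ 4 * M * (Q * L ^ 2) := by
    rintro q p r ⟨y, hy, hV⟩ x hx
    exact h.frame_of_isNearRational hQ hL hL1 h1 h2 (hT x hx).1 (hT y hy).1 (hTd x hx y hy) hV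
  have hline : ∀ q p r : ℤ, V q p r → |(p / q : ℝ) - x₀| ≤ 3 * L ∧
      |(r / q : ℝ) - f x₀ - f' x₀ * (p / q - x₀)| ≤ 4 * M * L ^ 2 := by
    intro q p r hV
    obtain ⟨g1, g2, g3⟩ := hVq q p r hV
    obtain ⟨k1, k2⟩ := hframe q p r hV x₀ hx₀
    constructor
    · have e : (p / q : ℝ) - x₀ = (p - q * x₀) / q := by field_simp
      rw [e, abs_div, abs_of_pos g2, div_le_iff₀ g2]
      exact k1.trans (by nlinarith)
    · have e : (r / q : ℝ) - f x₀ - f' x₀ * (p / q - x₀) = tangentDefect f f' q p r x₀ / q := by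
        rw [tangentDefect]; field_simp
      rw [e, abs_div, abs_of_pos g2, div_le_iff₀ g2]
      refine k2.trans ?_
      have : 0 ≤ 4 * M * L ^ 2 := by positivity
      nlinarith
  set Y := Q * L with hY
  have hY2 : 1 ≤ Y ^ 2 := one_le_pow₀ hQL
  have hY3 : Y ^ 2 ≤ Y ^ 3 := pow_le_pow_right₀ hQL (by norm_num)
  by_cases hdet : ∃ v : Fin 3 → Fin 3 → ℤ, (∀ i, V (v i 0) (v i 1) (v i 2)) ∧
      (Matrix.of v).det ≠ 0
  · obtain ⟨r1, r2⟩ := finite_ncard_le_of_det_le {v : Fin 3 → ℤ | V (v 0) (v 1) (v 2)}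
      (144 * M * Y ^ 3) (by
        intro v hv
        simp only [Set.mem_ofPred_eq] at hv
        have e : ((Matrix.of v).det : ℝ) =
            v 0 0 * ((v 1 1 - v 1 0 * x₀) * tangentDefect f f' (v 2 0) (v 2 1) (v 2 2) x₀ -
              (v 2 1 - v 2 0 * x₀) * tangentDefect f f' (v 1 0) (v 1 1) (v 1 2) x₀) -
            v 1 0 * ((v 0 1 - v 0 0 * x₀) * tangentDefect f f' (v 2 0) (v 2 1) (v 2 2) x₀ -
              (v 2 1 - v 2 0 * x₀) * tangentDefect f f' (v 0 0) (v 0 1) (v 0 2) x₀) +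
            v 2 0 * ((v 0 1 - v 0 0 * x₀) * tangentDefect f f' (v 1 0) (v 1 1) (v 1 2) x₀ -
              (v 1 1 - v 1 0 * x₀) * tangentDefect f f' (v 0 0) (v 0 1) (v 0 2) x₀) := by
          rw [Matrix.det_fin_three]
          simp only [Matrix.of_apply, tangentDefect]
          push_cast
          ring
        have hq : ∀ i, |(v i 0 : ℝ)| ≤ 2 * Q := fun i => by
          obtain ⟨_, g2, g3⟩ := hVq _ _ _ (hv i)
          rw [abs_of_pos g2]
          exact g3.le
        have hb : ∀ i j k, |(v i 0 : ℝ) *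
            ((v j 1 - v j 0 * x₀) * tangentDefect f f' (v k 0) (v k 1) (v k 2) x₀ -
              (v k 1 - v k 0 * x₀) * tangentDefect f f' (v j 0) (v j 1) (v j 2) x₀)| ≤
            48 * M * Y ^ 3 := by
          intro i j k
          obtain ⟨k1, k2⟩ := hframe _ _ _ (hv j) x₀ hx₀
          obtain ⟨l1, l2⟩ := hframe _ _ _ (hv k) x₀ hx₀
          rw [abs_mul]
          have e : 48 * M * Y ^ 3 = 2 * Q * (3 * Y * (4 * M * (Q * L ^ 2)) +
              3 * Y * (4 * M * (Q * L ^ 2))) := by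
            rw [hY]; ring
          rw [e]
          refine mul_le_mul (hq i) ((abs_sub _ _).trans ?_) (abs_nonneg _) (by positivity)
          rw [abs_mul, abs_mul]
          gcongr
        rw [e]
        have g1 := hb 0 1 2
        have g2 := hb 1 0 2
        have g3 := hb 2 0 1
        rw [abs_le] at *
        constructor <;> linarith) hdet
    have hsub : X ⊆ (fun v : Fin 3 → ℤ => ((v 1 / v 0 : ℝ), (v 2 / v 0 : ℝ))) ''
        {v : Fin 3 → ℤ | V (v 0) (v 1) (v 2)} := by
      rintro P ⟨q, p, r, hV, rfl⟩
      exact ⟨![q, p, r], hV, rfl⟩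
    have hfin := r1.image (fun v : Fin 3 → ℤ => ((v 1 / v 0 : ℝ), (v 2 / v 0 : ℝ)))
    refine ⟨hfin.subset hsub, ?_⟩
    have e : (X.ncard : ℝ) ≤ ({v : Fin 3 → ℤ | V (v 0) (v 1) (v 2)}.ncard : ℝ) := by
      exact_mod_cast (Set.ncard_le_ncard hsub hfin).trans (Set.ncard_image_le r1)
    refine e.trans (r2.trans_eq ?_)
    simp only [Fintype.card_fin]
    ring
  push Not at hdet
  have hcoplanar : ∀ q p r q' p' r' q'' p'' r'' : ℤ, V q p r → V q' p' r' → V q'' p'' r'' →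
      (p * r' - r * p') * q'' + (r * q' - q * r') * p'' + (q * p' - p * q') * r'' = 0 := by
    intro q p r q' p' r' q'' p'' r'' hV hV' hV''
    have := hdet ![![q, p, r], ![q', p', r'], ![q'', p'', r'']] (by
      intro i
      fin_cases i <;> simpa)
    rw [Matrix.det_fin_three] at this
    simp at this
    linarith
  have hfrac : ∀ {q p q' p' : ℤ}, (0 : ℝ) < q → (0 : ℝ) < q' → q * p' - p * q' = 0 →
      (p / q : ℝ) = p' / q' := by
    intro q p q' p' hq hq' h0
    have h1 : (q : ℝ) * p' - p * q' = 0 := by exact_mod_cast h0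
    rw [div_eq_div_iff hq.ne' hq'.ne']
    linarith
  have hspace : ∀ {q p r q' p' r' : ℤ} {s t : ℤ} {n : ℝ}, V q p r → V q' p' r' →
      n ≤ |(q * t - s * q' : ℤ)| → n / (4 * Q ^ 2) ≤ |(s / q : ℝ) - t / q'| := by
    intro q p r q' p' r' s t n hV hV' hn
    obtain ⟨g1, g2, g3⟩ := hVq _ _ _ hV
    obtain ⟨k1, k2, k3⟩ := hVq _ _ _ hV'
    have e : (s / q : ℝ) - t / q' = -((q * t - s * q' : ℤ) / (q * q')) := by
      push_cast
      field_simp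
      ring
    rw [e, abs_neg, abs_div, abs_of_pos (mul_pos g2 k2)]
    refine div_le_div₀ (abs_nonneg _) (by exact_mod_cast hn) (mul_pos g2 k2) ?_
    nlinarith
  by_cases hpar : ∀ q p r q' p' r' : ℤ, V q p r → V q' p' r' → q * p' - p * q' = 0
  · obtain ⟨r1, r2⟩ := finite_ncard_le_of_separated X Prod.snd (d := 1 / (4 * Q ^ 2))
      (W := 8 * M * L ^ 2) (by positivity) (by positivity) (by
        rintro _ ⟨q, p, r, hV, rfl⟩ _ ⟨q', p', r', hV', rfl⟩ hne
        have hP := hfrac (hVq _ _ _ hV).2.1 (hVq _ _ _ hV').2.1 (hpar _ _ _ _ _ _ hV hV')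
        refine hspace hV hV' ?_
        have : q * r' - r * q' ≠ 0 := fun h0 => hne
          (Prod.ext hP (hfrac (hVq _ _ _ hV).2.1 (hVq _ _ _ hV').2.1 h0))
        exact_mod_cast Int.one_le_abs this) (by
        rintro _ ⟨q, p, r, hV, rfl⟩ _ ⟨q', p', r', hV', rfl⟩
        have hP := hfrac (hVq _ _ _ hV).2.1 (hVq _ _ _ hV').2.1 (hpar _ _ _ _ _ _ hV hV')
        have e1 := (hline _ _ _ hV).2
        have e2 := (hline _ _ _ hV').2
        rw [hP] at e1
        simp only
        rw [abs_le] at *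
        constructor <;> linarith)
    refine ⟨r1, r2.trans ?_⟩
    have e : 2 + 2 * (8 * M * L ^ 2) / (1 / (4 * Q ^ 2)) = 2 + 64 * (M * Y ^ 2) := by
      rw [hY]; field_simp; ring
    rw [e]
    nlinarith
  classical
  have hex : ∃ n : ℕ, 0 < n ∧ ∃ q p r q' p' r' : ℤ, V q p r ∧ V q' p' r' ∧
      q * p' - p * q' = n := by
    push Not at hpar
    obtain ⟨q, p, r, q', p', r', hV, hV', hne⟩ := hpar
    rcases lt_or_gt_of_ne hne with h0 | h0
    · exact ⟨(q' * p - p' * q).toNat, by lia, q', p', r', q, p, r, hV', hV, by lia⟩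
    · exact ⟨(q * p' - p * q').toNat, by lia, q, p, r, q', p', r', hV, hV', by lia⟩
  obtain ⟨hn0, q, p, r, q', p', r', hV, hV', hn⟩ := Nat.find_spec hex
  have hmin := fun m => Nat.find_min' hex (m := m)
  set n := Nat.find hex
  have hn1 : (1 : ℝ) ≤ n := by exact_mod_cast hn0
  have hnpos : (0 : ℝ) < n := by linarith
  set a := p * r' - r * p'
  set b := r * q' - q * r'
  have hplane : ∀ q'' p'' r'' : ℤ, V q'' p'' r'' →
      (a : ℝ) + b * (p'' / q'') + n * (r'' / q'') = 0 := by
    intro q'' p'' r'' hV''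
    have e := hcoplanar q p r q' p' r' q'' p'' r'' hV hV' hV''
    rw [hn] at e
    have e' : (a : ℝ) * q'' + b * p'' + n * r'' = 0 := by exact_mod_cast e
    have := (hVq _ _ _ hV'').2.1
    field_simp
    linarith
  have hsep : ∀ P ∈ X, ∀ P' ∈ X, P ≠ P' → n / (4 * Q ^ 2) ≤ |P.1 - P'.1| := by
    rintro _ ⟨q, p, r, hV, rfl⟩ _ ⟨q', p', r', hV', rfl⟩ hne
    have hne' : q * p' - p * q' ≠ 0 := by
      intro h0
      have hP := hfrac (hVq _ _ _ hV).2.1 (hVq _ _ _ hV').2.1 h0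
      refine hne (Prod.ext hP ?_)
      have e1 := hplane _ _ _ hV
      have e2 := hplane _ _ _ hV'
      rw [hP] at e1
      have : (n : ℝ) * (r / q) = n * (r' / q') := by linarith
      exact mul_left_cancel₀ hnpos.ne' this
    refine hspace hV hV' ?_
    have hle : (n : ℤ) ≤ |q * p' - p * q'| := by
      rcases lt_or_gt_of_ne hne' with h0 | h0
      · have := hmin (q' * p - p' * q).toNat ⟨by lia, q', p', r', q, p, r, hV', hV, by lia⟩
        rw [abs_of_neg h0]
        lia
      · have := hmin (q * p' - p * q').toNat ⟨by lia, q, p, r, q', p', r', hV, hV', by lia⟩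
        rw [abs_of_pos h0]
        lia
    exact_mod_cast hle
  obtain ⟨r1, r2⟩ := finite_ncard_le_of_separated X Prod.fst (W := 6 * L) (by positivity)
    (by positivity) hsep (by
      rintro _ ⟨q, p, r, hV, rfl⟩ _ ⟨q', p', r', hV', rfl⟩
      have e1 := (hline _ _ _ hV).1
      have e2 := (hline _ _ _ hV').1
      simp only
      rw [abs_le] at *
      constructor <;> linarith)
  refine ⟨r1, ?_⟩
  by_contra hN
  have hMY : Y ^ 3 ≤ M * Y ^ 3 := le_mul_of_one_le_left (by positivity) hM1
  have hnδ : n * (Q * L ^ 2) ≤ 1 := by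
    by_contra! hlt
    have e : 2 + 2 * (6 * L) / (n / (4 * Q ^ 2)) ≤ 2 + 48 * Y ^ 3 := by
      have e : 2 * (6 * L) / (n / (4 * Q ^ 2)) = 48 * (L * Q ^ 2 / n) := by field_simp; norm_num
      have e1 : L * Q ^ 2 / n ≤ Y ^ 3 := by
        rw [div_le_iff₀ hnpos]
        have e2 : Y ^ 3 * n = L * Q ^ 2 * (n * (Q * L ^ 2)) := by rw [hY]; ring
        rw [e2]
        exact le_mul_of_one_le_right (by positivity) hlt.le
      rw [e]
      linarith
    linarith
  have hfar : ∃ P ∈ X, ∃ P' ∈ X, n * Q * L ^ 3 < |P.1 - P'.1| := by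
    by_contra! hcl
    obtain ⟨-, r3⟩ := finite_ncard_le_of_separated X Prod.fst (W := n * Q * L ^ 3) (by positivity)
      (by positivity) hsep hcl
    have e : 2 * (n * Q * L ^ 3) / (n / (4 * Q ^ 2)) = 8 * Y ^ 3 := by
      rw [hY]; field_simp; ring
    rw [e] at r3
    linarith
  obtain ⟨_, ⟨q₁, p₁, r₁, hV₁, rfl⟩, _, ⟨q₂, p₂, r₂, hV₂, rfl⟩, hfar⟩ := hfar
  simp only at hfar
  obtain ⟨k1, k2⟩ := hline _ _ _ hV₁
  obtain ⟨l1, l2⟩ := hline _ _ _ hV₂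
  have k3 := hplane _ _ _ hV₁
  have l3 := hplane _ _ _ hV₂
  set P₁ : ℝ := p₁ / q₁
  set P₂ : ℝ := p₂ / q₂
  set D₁ : ℝ := r₁ / q₁ - f x₀ - f' x₀ * (P₁ - x₀) with hD₁
  set D₂ : ℝ := r₂ / q₂ - f x₀ - f' x₀ * (P₂ - x₀) with hD₂
  have hF' : |(b : ℝ) + n * f' x₀| ≤ 8 * M / Y := by
    have e : ((b : ℝ) + n * f' x₀) * (P₁ - P₂) = n * (D₂ - D₁) := by
      rw [hD₁, hD₂]
      linarith
    have e1 : |(b : ℝ) + n * f' x₀| * |P₁ - P₂| ≤ n * (8 * M * L ^ 2) := by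
      rw [← abs_mul, e, abs_mul, abs_of_pos hnpos]
      gcongr
      refine (abs_sub _ _).trans ?_
      linarith
    have e2 : |(b : ℝ) + n * f' x₀| * (n * Q * L ^ 3) ≤ n * (8 * M * L ^ 2) :=
      le_trans (by gcongr) e1
    rw [le_div_iff₀ (by positivity)]
    have e3 : 0 < n * L ^ 2 := by positivity
    refine le_of_mul_le_mul_left ?_ e3
    rw [hY]
    linarith
  refine hTZ x₀ hx₀ ⟨a, b, n, by exact_mod_cast hn0, by exact_mod_cast hnδ, ?_, ?_⟩
  · have e : (a : ℝ) + b * x₀ + (n : ℤ) * f x₀ = -(((b : ℝ) + n * f' x₀) * (P₁ - x₀)) - n * D₁ := by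
      rw [hD₁, ← sub_eq_zero, ← k3]
      push_cast
      ring
    have e1 : |((b : ℝ) + n * f' x₀) * (P₁ - x₀)| ≤ 24 * M / Q := by
      rw [abs_mul]
      calc |(b : ℝ) + n * f' x₀| * |P₁ - x₀| ≤ 8 * M / Y * (3 * L) := by gcongr
        _ = _ := by rw [hY]; field_simp; norm_num
    have e2 : |(n : ℝ) * D₁| ≤ 4 * M / Q := by
      rw [abs_mul, abs_of_pos hnpos, le_div_iff₀ hQ]
      calc n * |D₁| * Q ≤ n * (4 * M * L ^ 2) * Q := by gcongr
        _ = 4 * M * (n * (Q * L ^ 2)) := by ring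
        _ ≤ 4 * M := mul_le_of_le_one_right (by positivity) hnδ
    rw [e]
    refine (abs_sub _ _).trans ?_
    rw [abs_neg]
    have : 28 * M / Q = 24 * M / Q + 4 * M / Q := by ring
    linarith
  · exact_mod_cast hF'

theorem volume_isNearRational_le (h : IsConvexArc f f' J M) {α : ℝ}
    (hJ : J ⊆ Set.Icc α (α + 1)) {Q L δ₁ δ₂ : ℝ} (hQ : 0 < Q)
    (hL : 0 < L) (hQL : 1 ≤ Q * L) (hδ : Q * L ^ 2 ≤ 1) (h1 : δ₁ ≤ Q * L ^ 2)
    (h2 : δ₂ ≤ Q * L ^ 2) (hδ₁ : 0 ≤ δ₁) (hδ₂ : 0 ≤ δ₂) :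
    volume {x | x ∈ J ∧ ∃ q p r : ℤ, IsNearRational f Q δ₁ δ₂ q p r x} ≤
      volume {x | x ∈ J ∧ ∃ a b c : ℤ, 1 ≤ c ∧ c * (Q * L ^ 2) ≤ 1 ∧
        IsAlmostTangent f f' (28 * M / Q) (8 * M / (Q * L)) a b c x} +
      ENNReal.ofReal ((1 / L + 1) * (3888 * M * (Q * L) ^ 3 * (2 * M * min δ₁ δ₂ / Q))) := by
  have hM := h.pos
  refine (measure_mono (Set.subset_union_right.trans Set.union_sdiff_self.symm.subset)).trans
    ((measure_union_le _ _).trans (add_le_add_right ?_ _))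
  refine volume_le_of_short_pieces hL (by positivity) (fun x hx => hJ hx.1.1) fun T hT hTd => ?_
  exact h.volume_isNearRational_short_le hQ hL hQL hδ h1 h2 hδ₁ hδ₂ (fun x hx => (hT hx).1)
    (fun x hx hW => (hT hx).2 ⟨(hT hx).1.1, hW⟩) hTd

theorem volume_isAlmostTangent_dyadic_le (h : IsConvexArc f f' J M) {α : ℝ}
    (hJ : J ⊆ Set.Icc α (α + 1)) {A u : ℝ} (hA : 1 ≤ A) (hAu : A ≤ u ^ 18) (hu : 1 ≤ u)
    (huM : 96 * M ≤ u ^ 7) :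
    volume {x | x ∈ J ∧ ∃ a b c : ℤ, A ≤ c ∧ c < 2 * A ∧
      IsAlmostTangent f f' (28 * M / u ^ 32) (8 * M / u ^ 7) a b c x} ≤
      ENNReal.ofReal (12064 * M ^ 3 / u) := by
  have hM := h.pos
  have hM1 := h.one_le
  have hA0 : 0 < A := by linarith
  have hu0 : 0 < u := by linarith
  refine (h.volume_isAlmostTangent_le hJ (R := A / u ^ 6) hA (by positivity) ?_ (by positivity) ?_
    (by positivity)).trans (ENNReal.ofReal_le_ofReal ?_)
  · have e : 144 * M * A * (28 * M / u ^ 32) = 4032 * M ^ 2 * A / u ^ 32 := by ring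
    rw [e, div_le_one (by positivity)]
    calc 4032 * M ^ 2 * A ≤ (96 * M) * (96 * M) * A := by nlinarith [sq_nonneg M]
      _ ≤ u ^ 7 * u ^ 7 * u ^ 18 := by gcongr
      _ = u ^ 32 := by ring
  · rw [div_le_div_iff₀ (by positivity) (by norm_num)]
    linarith
  · have e1 : A / u ^ 6 * (8 * (A / u ^ 6) * (18 * M * (2 * (4 * M * (8 * M / u ^ 7) / A +
        2 * (28 * M / u ^ 32) / (8 * M / u ^ 7))))) =
        288 * M * (32 * M ^ 2 * (A / u ^ 18) * (1 / u) + 7 * (A / u ^ 18) ^ 2 * (1 / u)) := by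
      field_simp; ring
    have e2 : (12 * M * A + 1) * ((2 + 2 * A / (A / u ^ 6)) * (2 * M * (8 * M / u ^ 7 / A))) =
        (12 * M * A + 1) / A * (2 + 2 * u ^ 6) / u ^ 6 * (16 * M ^ 2 * (1 / u)) := by
      field_simp; ring
    have hAu' : A / u ^ 18 ≤ 1 := by rwa [div_le_one (by positivity)]
    have g0 : 0 < 1 / u := by positivity
    have g1 : 288 * M * (32 * M ^ 2 * (A / u ^ 18) * (1 / u) + 7 * (A / u ^ 18) ^ 2 * (1 / u)) ≤
        288 * M * (32 * M ^ 2 * 1 * (1 / u) + 7 * 1 ^ 2 * (1 / u)) := by gcongr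
    have g2 : (12 * M * A + 1) / A ≤ 13 * M := by
      rw [div_le_iff₀ hA0]
      nlinarith
    have g3 : (12 * M * A + 1) / A * (2 + 2 * u ^ 6) / u ^ 6 ≤ 13 * M * 4 := by
      rw [mul_div_assoc]
      refine mul_le_mul g2 ?_ (by positivity) (by positivity)
      rw [div_le_iff₀ (by positivity)]
      have := one_le_pow₀ hu (n := 6)
      linarith
    have g4 : (12 * M * A + 1) / A * (2 + 2 * u ^ 6) / u ^ 6 * (16 * M ^ 2 * (1 / u)) ≤
        13 * M * 4 * (16 * M ^ 2 * (1 / u)) := by gcongr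
    have g5 : M * (1 / u) ≤ M ^ 3 * (1 / u) := by
      gcongr
      exact le_self_pow₀ hM1 (by norm_num)
    have g6 : 12064 * M ^ 3 / u = 12064 * (M ^ 3 * (1 / u)) := by ring
    rw [e1, e2, g6]
    linarith

theorem volume_isAlmostTangent_all_le (h : IsConvexArc f f' J M) {α : ℝ}
    (hJ : J ⊆ Set.Icc α (α + 1)) {u : ℝ} {n : ℕ} (hu : 1 ≤ u) (hn : u ^ 32 = 2 ^ n)
    (huM : 96 * M ≤ u ^ 7) :
    volume {x | x ∈ J ∧ ∃ a b c : ℤ, 1 ≤ c ∧ c ≤ u ^ 18 ∧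
      IsAlmostTangent f f' (28 * M / u ^ 32) (8 * M / u ^ 7) a b c x} ≤
      ENNReal.ofReal ((n + 1) * (12064 * M ^ 3 / u)) := by
  have hM := h.pos
  have hsub : {j : ℕ | (2 : ℝ) ^ j ≤ u ^ 18} ⊆ Set.Iio (n + 1) := by
    intro j hj
    have h1 : (2 : ℝ) ^ j ≤ 2 ^ n := hn ▸ le_trans hj (pow_le_pow_right₀ hu (by norm_num))
    exact Nat.lt_succ_of_le ((pow_le_pow_iff_right₀ (by norm_num)).1 h1)
  refine measure_le_of_subset_biUnion ((Set.finite_Iio _).subset hsub)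
    (U := fun j => {x | x ∈ J ∧ ∃ a b c : ℤ, (2 : ℝ) ^ j ≤ c ∧ c < 2 * (2 : ℝ) ^ j ∧
      IsAlmostTangent f f' (28 * M / u ^ 32) (8 * M / u ^ 7) a b c x}) (by positivity) ?_ ?_ ?_
  · have h1 := Set.ncard_le_ncard hsub (Set.finite_Iio _)
    rw [← Finset.coe_Iio, Set.ncard_coe_finset, Nat.card_Iio] at h1
    exact_mod_cast h1
  · rintro x ⟨hx, a, b, c, h1, h2, h3⟩
    have hc : ((c.toNat : ℤ) : ℝ) = c := by
      rw [Int.toNat_of_nonneg (by lia)]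
    have l1 : (2 : ℝ) ^ Nat.log 2 c.toNat ≤ c := by
      rw [← hc]
      exact_mod_cast Nat.pow_log_le_self 2 (by lia)
    have l2 : (c : ℝ) < 2 * (2 : ℝ) ^ Nat.log 2 c.toNat := by
      rw [← hc, ← pow_succ']
      exact_mod_cast Nat.lt_pow_succ_log_self (by norm_num) c.toNat
    exact Set.mem_biUnion (x := Nat.log 2 c.toNat) (l1.trans h2) ⟨hx, a, b, c, l1, l2, h3⟩
  · intro j hj
    exact h.volume_isAlmostTangent_dyadic_le hJ (one_le_pow₀ (by norm_num)) hj hu huM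

theorem volume_isNearRational_dyadic_le (h : IsConvexArc f f' J M) {α : ℝ}
    (hJ : J ⊆ Set.Icc α (α + 1)) {u δ₁ δ₂ : ℝ} {n : ℕ} (hu : 1 ≤ u) (hn : u ^ 32 = 2 ^ n)
    (huM : 96 * M ≤ u ^ 7) (hδ₁ : 0 ≤ δ₁) (hδ₂ : 0 ≤ δ₂) (h1 : δ₁ ≤ 1) (h2 : δ₂ ≤ 1) :
    volume {x | x ∈ J ∧ ∃ q p r : ℤ, IsNearRational f (2 ^ n) δ₁ δ₂ q p r x} ≤
      ENNReal.ofReal (31104 * M ^ 3 * ((n + 1) * (1 / u) + 2 ^ n * (δ₁ * δ₂))) := by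
  have hM := h.pos
  have hM1 := h.one_le
  have hu0 : 0 < u := by linarith
  rw [← hn]
  set δ := max (max δ₁ δ₂) (1 / u ^ 18) with hδ
  have hδ0 : 0 < δ := lt_max_of_lt_right (by positivity)
  have hδ1 : δ ≤ 1 := max_le (max_le h1 h2) (by
    rw [div_le_one (by positivity)]
    exact one_le_pow₀ hu)
  have hδu : 1 / u ^ 18 ≤ δ := le_max_right _ _
  set L := √(δ / u ^ 32) with hL
  have hL0 : 0 < L := Real.sqrt_pos.2 (by positivity)
  have hL2 : u ^ 32 * L ^ 2 = δ := by
    rw [hL, Real.sq_sqrt (by positivity)]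
    field_simp
  have hQL : u ^ 7 ≤ u ^ 32 * L := by
    refine le_of_sq_le_sq ?_ (by positivity)
    have e : (u ^ 32 * L) ^ 2 = u ^ 32 * δ := by rw [← hL2]; ring
    rw [e]
    calc (u ^ 7) ^ 2 = u ^ 32 * (1 / u ^ 18) := by field_simp
      _ ≤ _ := by gcongr
  have hL1 : L ≤ 1 := Real.sqrt_le_one.2 ((div_le_one (by positivity)).2
    (hδ1.trans (one_le_pow₀ hu)))
  refine (h.volume_isNearRational_le hJ (L := L) (by positivity) hL0
    ((one_le_pow₀ hu).trans hQL) (hL2.trans_le hδ1)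
    (hL2 ▸ (le_max_left _ _).trans (le_max_left _ _))
    (hL2 ▸ (le_max_right _ _).trans (le_max_left _ _)) hδ₁ hδ₂).trans ?_
  have hZ : volume {x | x ∈ J ∧ ∃ a b c : ℤ, 1 ≤ c ∧ c * (u ^ 32 * L ^ 2) ≤ 1 ∧
      IsAlmostTangent f f' (28 * M / u ^ 32) (8 * M / (u ^ 32 * L)) a b c x} ≤
      ENNReal.ofReal ((n + 1) * (12064 * M ^ 3 / u)) := by
    refine (measure_mono ?_).trans (h.volume_isAlmostTangent_all_le hJ hu hn huM)
    rintro x ⟨hx, a, b, c, g1, g2, g3⟩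
    refine ⟨hx, a, b, c, g1, ?_, g3.abs_le, g3.abs_deriv_le.trans ?_⟩
    · rw [hL2] at g2
      have g1' : (1 : ℝ) ≤ c := by exact_mod_cast g1
      have : (c : ℝ) * (1 / u ^ 18) ≤ 1 := le_trans (by gcongr) g2
      rwa [mul_one_div, div_le_one (by positivity)] at this
    · gcongr
  refine (add_le_add_left hZ _).trans ?_
  have hm0 : 0 ≤ min δ₁ δ₂ := le_min hδ₁ hδ₂
  rw [← ENNReal.ofReal_add (by positivity) (by positivity)]
  refine ENNReal.ofReal_le_ofReal ?_
  have e1 : (1 / L + 1) * (3888 * M * (u ^ 32 * L) ^ 3 * (2 * M * min δ₁ δ₂ / u ^ 32)) ≤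
      15552 * M ^ 2 * (u ^ 32 * δ * min δ₁ δ₂) := by
    have k1 : 1 / L + 1 ≤ 2 / L := by
      rw [le_div_iff₀ hL0, add_mul, div_mul_cancel₀ _ hL0.ne']
      linarith
    refine (mul_le_mul_of_nonneg_right k1 (by positivity)).trans_eq ?_
    rw [← hL2]
    field_simp
    ring
  have hprod : min δ₁ δ₂ * max δ₁ δ₂ = δ₁ * δ₂ := min_mul_max δ₁ δ₂
  have e2 : δ * min δ₁ δ₂ ≤ δ₁ * δ₂ + 1 / u ^ 18 * min δ₁ δ₂ := by
    have k1 : δ ≤ max δ₁ δ₂ + 1 / u ^ 18 :=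
      max_le (by linarith [show 0 < 1 / u ^ 18 by positivity])
        (by linarith [hδ₁.trans (le_max_left δ₁ δ₂)])
    have k2 := mul_le_mul_of_nonneg_right k1 hm0
    linarith
  have e3 : u ^ 32 * δ * min δ₁ δ₂ ≤ u ^ 32 * (δ₁ * δ₂) + u ^ 14 * min δ₁ δ₂ := by
    calc u ^ 32 * δ * min δ₁ δ₂ = u ^ 32 * (δ * min δ₁ δ₂) := by ring
      _ ≤ u ^ 32 * (δ₁ * δ₂ + 1 / u ^ 18 * min δ₁ δ₂) := by gcongr
      _ = _ := by field_simp
  have e4 : u ^ 14 * min δ₁ δ₂ ≤ u ^ 32 * (δ₁ * δ₂) + 1 / u := by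
    have k1 : min δ₁ δ₂ * min δ₁ δ₂ ≤ δ₁ * δ₂ := hprod ▸ by
      gcongr
      exact min_le_max
    have k2 : u ^ 30 * (min δ₁ δ₂ * min δ₁ δ₂) ≤ u ^ 32 * (δ₁ * δ₂) := by
      gcongr
      norm_num
    have k3 : (1 / u) ^ 2 ≤ 1 / u := by
      have : 1 / u ≤ 1 := (div_le_one hu0).2 hu
      have : 0 < 1 / u := by positivity
      nlinarith
    have k4 : u ^ 14 * min δ₁ δ₂ = (u ^ 15 * min δ₁ δ₂) * (1 / u) := by field_simp
    have k5 : (u ^ 15 * min δ₁ δ₂) ^ 2 = u ^ 30 * (min δ₁ δ₂ * min δ₁ δ₂) := by ring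
    have k6 : 0 ≤ (u ^ 15 * min δ₁ δ₂) * (1 / u) := by positivity
    nlinarith [two_mul_le_add_sq (u ^ 15 * min δ₁ δ₂) (1 / u)]
  have e5 : 15552 * M ^ 2 * (u ^ 32 * δ * min δ₁ δ₂) ≤
      15552 * M ^ 3 * (2 * (u ^ 32 * (δ₁ * δ₂)) + 1 / u) := by
    have : u ^ 32 * δ * min δ₁ δ₂ ≤ 2 * (u ^ 32 * (δ₁ * δ₂)) + 1 / u := by linarith
    gcongr
    norm_num
  have e6 : (n + 1) * (12064 * M ^ 3 / u) = 12064 * M ^ 3 * ((n + 1) * (1 / u)) := by ring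
  have e7 : M ^ 3 * (1 / u) ≤ M ^ 3 * ((n + 1) * (1 / u)) := by
    gcongr
    refine le_mul_of_one_le_left (by positivity) ?_
    linarith [Nat.cast_nonneg (α := ℝ) n]
  have e8 : 0 ≤ M ^ 3 * ((n + 1) * (1 / u)) := by positivity
  rw [e6]
  linarith

end IsConvexArc

theorem bddBelow_range_abs_sub_intCast (y : ℝ) : BddBelow (Set.range fun z : ℤ => |y - z|) :=
  ⟨0, by rintro _ ⟨z, rfl⟩; exact abs_nonneg _⟩

theorem nint_lt_one (y : ℝ) : nint y < 1 :=
  ((ciInf_le (bddBelow_range_abs_sub_intCast y) (round y)).trans (abs_sub_round y)).trans_lt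
    (by norm_num)

theorem nint_neg (y : ℝ) : nint (-y) = nint y := by
  rw [nint, nint, ← (Equiv.neg ℤ).iInf_comp]
  congr 1
  ext z
  rw [← abs_neg]
  simp [sub_eq_add_neg, add_comm]

theorem exists_abs_sub_le_of_nint_lt {y δ : ℝ} (h : nint y < δ) : ∃ z : ℤ, |z - y| ≤ δ := by
  obtain ⟨z, hz⟩ := exists_lt_of_ciInf_lt h
  exact ⟨z, abs_sub_comm y z ▸ hz.le⟩

theorem summable_two_pow_mul_of_antitone {ψ₁ ψ₂ : ℕ → ℝ} (hψ₁ : ∀ q, 0 ≤ ψ₁ q)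
    (hψ₂ : ∀ q, 0 ≤ ψ₂ q) (h₁ : Antitone ψ₁) (h₂ : Antitone ψ₂)
    (hsum : Summable fun q => ψ₁ q * ψ₂ q) :
    Summable fun n : ℕ => (2 : ℝ) ^ n * (ψ₁ (2 ^ n) * ψ₂ (2 ^ n)) :=
  (summable_condensed_iff_of_nonneg (fun q => mul_nonneg (hψ₁ q) (hψ₂ q))
    fun _ _ _ hmn => mul_le_mul (h₁ hmn) (h₂ hmn) (hψ₂ _) (hψ₁ _)).2 hsum

namespace IsConvexArc

variable {f f' : ℝ → ℝ} {J : Set ℝ} {M : ℝ}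

theorem volume_eq_zero_of_le_one (h : IsConvexArc f f' J M) {α : ℝ} (hJ : J ⊆ Set.Icc α (α + 1))
    {ψ₁ ψ₂ : ℕ → ℝ} (hψ₁ : ∀ q, 0 ≤ ψ₁ q) (hψ₂ : ∀ q, 0 ≤ ψ₂ q) (h₁ : Antitone ψ₁)
    (h₂ : Antitone ψ₂) (hle₁ : ∀ q, ψ₁ q ≤ 1) (hle₂ : ∀ q, ψ₂ q ≤ 1)
    (hsum : Summable fun q => ψ₁ q * ψ₂ q) :
    volume {x | x ∈ J ∧
      {q : ℕ | 0 < q ∧ nint (q * x) < ψ₁ q ∧ nint (q * f x) < ψ₂ q}.Infinite} = 0 := by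
  have hM := h.pos
  set v : ℝ := 2 ^ (1 / 32 : ℝ) with hv
  have hv1 : 1 < v := Real.one_lt_rpow (by norm_num) (by norm_num)
  have hv0 : 0 < v := by linarith
  have hv32 : v ^ 32 = 2 := by
    rw [hv, ← Real.rpow_natCast, ← Real.rpow_mul (by norm_num)]
    norm_num
  obtain ⟨N, hN⟩ := pow_unbounded_of_one_lt (96 * M) hv1
  set g : ℕ → ℝ := fun n => 31104 * M ^ 3 * ((n + 1) * (1 / v ^ n) +
    2 ^ n * (ψ₁ (2 ^ n) * ψ₂ (2 ^ n)))
  have hvinv : ‖v⁻¹‖ < 1 := by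
    rw [norm_inv, Real.norm_of_nonneg hv0.le]
    exact inv_lt_one_of_one_lt₀ hv1
  have hg : Summable g := by
    refine Summable.mul_left _ (Summable.add ?_
      (summable_two_pow_mul_of_antitone hψ₁ hψ₂ h₁ h₂ hsum))
    refine ((summable_pow_mul_geometric_of_norm_lt_one 1 hvinv).add
      (summable_geometric_of_norm_lt_one hvinv)).congr fun n => ?_
    simp only [pow_one, inv_pow, one_div]
    ring
  have hBC : volume {x | ∃ᶠ n in atTop, N ≤ n ∧ x ∈ J ∧
      ∃ q p r : ℤ, IsNearRational f (2 ^ n) (ψ₁ (2 ^ n)) (ψ₂ (2 ^ n)) q p r x} = 0 := by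
    refine measure_setOfPred_frequently_eq_zero (ne_top_of_le_ne_top hg.tsum_ofReal_ne_top
      (ENNReal.tsum_le_tsum fun n => ?_))
    by_cases hn : N ≤ n
    · simp only [hn, true_and]
      refine h.volume_isNearRational_dyadic_le hJ (one_le_pow₀ hv1.le) ?_ ?_ (hψ₁ _) (hψ₂ _)
        (hle₁ _) (hle₂ _)
      · rw [← pow_mul, mul_comm, pow_mul, hv32]
      · rw [← pow_mul]
        exact hN.le.trans (pow_le_pow_right₀ hv1.le (by lia))
    · simp [hn]
  refine measure_mono_null ?_ hBC
  rintro x ⟨hx, hinf⟩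
  refine frequently_atTop.2 fun n => ?_
  obtain ⟨q, ⟨hq0, hq1, hq2⟩, hq⟩ := hinf.exists_gt (2 ^ max n N)
  have hlog : max n N ≤ Nat.log 2 q := Nat.le_log_of_pow_le (by norm_num) hq.le
  have l1 := Nat.pow_log_le_self 2 hq0.ne'
  obtain ⟨p, hp⟩ := exists_abs_sub_le_of_nint_lt hq1
  obtain ⟨r, hr⟩ := exists_abs_sub_le_of_nint_lt hq2
  refine ⟨Nat.log 2 q, (le_max_left _ _).trans hlog, (le_max_right _ _).trans hlog, hx, q, p, r,
    ?_, ?_, ?_, ?_⟩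
  · exact_mod_cast l1
  · rw [← pow_succ']
    exact_mod_cast Nat.lt_pow_succ_log_self (by norm_num) q
  · exact_mod_cast hp.trans (h₁ l1)
  · exact_mod_cast hr.trans (h₂ l1)

theorem volume_eq_zero (h : IsConvexArc f f' J M) {α : ℝ} (hJ : J ⊆ Set.Icc α (α + 1))
    {ψ₁ ψ₂ : ℕ → ℝ} (hψ₁ : ∀ q, 0 ≤ ψ₁ q) (hψ₂ : ∀ q, 0 ≤ ψ₂ q) (h₁ : Antitone ψ₁)
    (h₂ : Antitone ψ₂) (hsum : Summable fun q => ψ₁ q * ψ₂ q) :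
    volume {x | x ∈ J ∧
      {q : ℕ | 0 < q ∧ nint (q * x) < ψ₁ q ∧ nint (q * f x) < ψ₂ q}.Infinite} = 0 := by
  have h0 := h.volume_eq_zero_of_le_one hJ (ψ₁ := fun q => min (ψ₁ q) 1)
    (ψ₂ := fun q => min (ψ₂ q) 1) (fun q => le_min (hψ₁ q) zero_le_one)
    (fun q => le_min (hψ₂ q) zero_le_one) (fun _ _ hq => min_le_min_right _ (h₁ hq))
    (fun _ _ hq => min_le_min_right _ (h₂ hq)) (fun q => min_le_right _ _)
    (fun q => min_le_right _ _) (hsum.of_nonneg_of_le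
      (fun q => mul_nonneg (le_min (hψ₁ q) zero_le_one) (le_min (hψ₂ q) zero_le_one))
      fun q => mul_le_mul (min_le_left _ _) (min_le_left _ _) (le_min (hψ₂ q) zero_le_one) (hψ₁ q))
  simpa only [lt_min_iff, nint_lt_one, and_true] using h0

end IsConvexArc

theorem exists_sub_eq_mul_sub {g g' : ℝ → ℝ} {J : Set ℝ} [hJ : J.OrdConnected]
    (hg : ∀ x ∈ J, HasDerivAt g (g' x) x) {x y : ℝ} (hx : x ∈ J) (hy : y ∈ J) :
    ∃ c ∈ Set.uIcc x y, c ∈ J ∧ g y - g x = g' c * (y - x) := by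
  rcases lt_trichotomy x y with hxy | rfl | hxy
  · obtain ⟨c, hc, e⟩ := exists_hasDerivAt_eq_slope g g' hxy
      (fun z hz => (hg z (hJ.out hx hy hz)).continuousAt.continuousWithinAt)
      fun z hz => hg z (hJ.out hx hy (Set.Ioo_subset_Icc_self hz))
    refine ⟨c, Set.Icc_subset_uIcc (Set.Ioo_subset_Icc_self hc),
      hJ.out hx hy (Set.Ioo_subset_Icc_self hc), ?_⟩
    rw [e, div_mul_cancel₀ _ (sub_pos.2 hxy).ne']
  · exact ⟨x, Set.left_mem_uIcc, hx, by simp⟩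
  · obtain ⟨c, hc, e⟩ := exists_hasDerivAt_eq_slope g g' hxy
      (fun z hz => (hg z (hJ.out hy hx hz)).continuousAt.continuousWithinAt)
      fun z hz => hg z (hJ.out hy hx (Set.Ioo_subset_Icc_self hz))
    refine ⟨c, Set.Icc_subset_uIcc' (Set.Ioo_subset_Icc_self hc),
      hJ.out hy hx (Set.Ioo_subset_Icc_self hc), ?_⟩
    have := (sub_pos.2 hxy).ne'
    rw [e]
    field_simp
    ring

theorem isConvexArc_of_hasDerivAt {f f' f'' : ℝ → ℝ} {J : Set ℝ} [J.OrdConnected] {M : ℝ}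
    (hM : 1 ≤ M) (hf : ∀ x ∈ J, HasDerivAt f (f' x) x) (hf' : ∀ x ∈ J, HasDerivAt f' (f'' x) x)
    (hle : ∀ x ∈ J, |f' x| ≤ M) (hge : ∀ x ∈ J, 1 ≤ M * |f' x|) (hle' : ∀ x ∈ J, f'' x ≤ M)
    (hge' : ∀ x ∈ J, 1 / M ≤ f'' x) : IsConvexArc f f' J M where
  one_le := hM
  abs_deriv_le := hle
  abs_sub_le x hx y hy := by
    obtain ⟨c, -, hc, e⟩ := exists_sub_eq_mul_sub hf hy hx
    rw [e, abs_mul, ← mul_assoc]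
    exact le_mul_of_one_le_left (abs_nonneg _) (hge c hc)
  deriv_lower x hx y hy hxy := by
    obtain ⟨c, -, hc, e⟩ := exists_sub_eq_mul_sub hf' hx hy
    rw [e, div_eq_mul_one_div, mul_comm]
    exact mul_le_mul_of_nonneg_right (hge' c hc) (sub_nonneg.2 hxy)
  deriv_upper x hx y hy hxy := by
    obtain ⟨c, -, hc, e⟩ := exists_sub_eq_mul_sub hf' hx hy
    rw [e]
    exact mul_le_mul_of_nonneg_right (hle' c hc) (sub_nonneg.2 hxy)
  taylor_lower x hx y hy := by
    have hM0 : 0 < M := by linarith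
    obtain ⟨c, hcxy, hc, e⟩ := exists_sub_eq_mul_sub (J := J)
      (g := fun z => f z - f' x * (z - x) - (z - x) ^ 2 / (2 * M))
      (g' := fun z => f' z - f' x - (z - x) / M) (fun z hz => by
        have k1 := (hasDerivAt_id z).sub_const x
        refine (((hf z hz).sub (k1.const_mul (f' x))).sub
          ((k1.pow 2).div_const (2 * M))).congr_deriv ?_
        simp only [id]
        field_simp
        ring) hx hy
    obtain ⟨d, -, hd, e'⟩ := exists_sub_eq_mul_sub hf' hx hc
    have k1 : f' c - f' x - (c - x) / M = (f'' d - 1 / M) * (c - x) := by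
      rw [e']; ring
    have k2 : 0 ≤ (c - x) * (y - x) := by
      rcases Set.mem_uIcc.1 hcxy with hc | hc
      · exact mul_nonneg (by linarith) (by linarith)
      · exact mul_nonneg_of_nonpos_of_nonpos (by linarith) (by linarith)
    have k3 : 0 ≤ (f'' d - 1 / M) * ((c - x) * (y - x)) :=
      mul_nonneg (sub_nonneg.2 (hge' d hd)) k2
    have k4 : f y - f x - f' x * (y - x) - (y - x) ^ 2 / (2 * M) =
        (f'' d - 1 / M) * ((c - x) * (y - x)) := by
      rw [← mul_assoc, ← k1, ← e]
      ring
    linarith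
  taylor_upper x hx y hy := by
    have hM0 : 0 < M := by linarith
    obtain ⟨c, hcxy, hc, e⟩ := exists_sub_eq_mul_sub hf hx hy
    obtain ⟨d, -, hd, e'⟩ := exists_sub_eq_mul_sub hf' hx hc
    have k2 : 0 ≤ (c - x) * (y - x) ∧ (c - x) * (y - x) ≤ (y - x) ^ 2 := by
      rcases Set.mem_uIcc.1 hcxy with hc | hc
      · constructor <;> nlinarith
      · constructor <;> nlinarith
    calc f y - f x - f' x * (y - x) = (f' c - f' x) * (y - x) := by rw [e]; ring
      _ = f'' d * ((c - x) * (y - x)) := by rw [e']; ring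
      _ ≤ M * (y - x) ^ 2 := mul_le_mul (hle' d hd) k2.2 k2.1 hM0.le

theorem exists_nhds_isConvexArc {f : ℝ → ℝ} {I : Set ℝ} (hI : IsOpen I) (hf : ContDiffOn ℝ 2 f I)
    {x₀ : ℝ} (hx₀ : x₀ ∈ I) (h1 : deriv f x₀ ≠ 0) (h2 : 0 < iteratedDeriv 2 f x₀) :
    ∃ J ∈ nhds x₀, ∃ M α : ℝ, J ⊆ Set.Icc α (α + 1) ∧ IsConvexArc f (deriv f) J M := by
  have hd : ContDiffOn ℝ 1 (deriv f) I := hf.deriv_of_isOpen hI (by norm_num)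
  have hdd : ContDiffOn ℝ 0 (deriv (deriv f)) I := hd.deriv_of_isOpen hI (by norm_num)
  have e2 : iteratedDeriv 2 f = deriv (deriv f) := by
    rw [iteratedDeriv_succ, iteratedDeriv_one]
  rw [e2] at h2
  have hIx := hI.mem_nhds hx₀
  have hc1 : ContinuousAt (fun x => |deriv f x|) x₀ := (hd.continuousOn.continuousAt hIx).abs
  have hc2 : ContinuousAt (deriv (deriv f)) x₀ := hdd.continuousOn.continuousAt hIx
  have h1' := abs_pos.2 h1
  set a := |deriv f x₀|
  set b := deriv (deriv f) x₀
  have hev : ∀ᶠ x in nhds x₀, x ∈ I ∧ (a / 2 < |deriv f x| ∧ |deriv f x| < a + 1) ∧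
      (b / 2 < deriv (deriv f) x ∧ deriv (deriv f) x < b + 1) := by
    refine (hI.eventually_mem hx₀).and (((hc1.eventually_const_lt (half_lt_self h1')).and
      (hc1.eventually_lt_const (lt_add_one _))).and ((hc2.eventually_const_lt (half_lt_self h2)).and
      (hc2.eventually_lt_const (lt_add_one _))))
  obtain ⟨r, hr, hball⟩ := Metric.eventually_nhds_iff_ball.1 hev
  set s := min r (1 / 2)
  have hs : 0 < s := lt_min hr (by norm_num)
  refine ⟨Set.Ioo (x₀ - s) (x₀ + s), Ioo_mem_nhds (by linarith) (by linarith),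
    1 + (a + 1) + (b + 1) + 2 / a + 2 / b, x₀ - 1 / 2, ?_, ?_⟩
  · have := min_le_right r (1 / 2)
    exact fun x hx => ⟨by linarith [hx.1], by linarith [hx.2]⟩
  have hJ : ∀ x ∈ Set.Ioo (x₀ - s) (x₀ + s), x ∈ I ∧
      (a / 2 < |deriv f x| ∧ |deriv f x| < a + 1) ∧
      (b / 2 < deriv (deriv f) x ∧ deriv (deriv f) x < b + 1) := by
    intro x hx
    refine hball x (Metric.ball_subset_ball (min_le_left r (1 / 2)) ?_)
    rwa [Real.ball_eq_Ioo]
  have ha2 : 0 < 2 / a := by positivity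
  have hb2 : 0 < 2 / b := by positivity
  refine isConvexArc_of_hasDerivAt (f'' := deriv (deriv f)) (by linarith) (fun x hx => ?_)
    (fun x hx => ?_) (fun x hx => ?_) (fun x hx => ?_) (fun x hx => ?_) (fun x hx => ?_)
  · exact ((hf.differentiableOn (by norm_num)).differentiableAt
      (hI.mem_nhds (hJ x hx).1)).hasDerivAt
  · exact ((hd.differentiableOn (by norm_num)).differentiableAt
      (hI.mem_nhds (hJ x hx).1)).hasDerivAt
  · linarith [(hJ x hx).2.1.2]
  · calc (1 : ℝ) = 2 / a * (a / 2) := by field_simp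
      _ ≤ _ := mul_le_mul (by linarith) (hJ x hx).2.1.1.le (by positivity) (by positivity)
  · linarith [(hJ x hx).2.2.2]
  · refine le_trans ?_ (hJ x hx).2.2.1.le
    calc _ ≤ 1 / (2 / b) := one_div_le_one_div_of_le hb2 (by linarith)
      _ = b / 2 := by rw [one_div_div]

theorem volume_curve_inter_eq_zero {f : ℝ → ℝ} {I : Set ℝ} (hI : IsOpen I)
    (hf : ContDiffOn ℝ 2 f I) (h1 : ∀ x ∈ I, deriv f x ≠ 0) (h2 : ∀ x ∈ I, iteratedDeriv 2 f x ≠ 0)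
    {ψ₁ ψ₂ : ℕ → ℝ} (hψ₁ : ∀ q, 0 ≤ ψ₁ q) (hψ₂ : ∀ q, 0 ≤ ψ₂ q) (hψ₁' : Antitone ψ₁)
    (hψ₂' : Antitone ψ₂) (hsum : Summable fun q => ψ₁ q * ψ₂ q) :
    volume {x | x ∈ I ∧
      {q : ℕ | 0 < q ∧ nint (q * x) < ψ₁ q ∧ nint (q * f x) < ψ₂ q}.Infinite} = 0 := by
  refine measure_null_of_locally_null _ fun x₀ hx₀ => ?_
  rcases lt_or_gt_of_ne (h2 x₀ hx₀.1) with h0 | h0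
  · obtain ⟨J, hJ, M, α, hJα, harc⟩ := exists_nhds_isConvexArc (f := -f) hI hf.neg hx₀.1
      (by rw [deriv.neg]; exact neg_ne_zero.2 (h1 x₀ hx₀.1))
      (by rw [iteratedDeriv_neg]; exact neg_pos.2 h0)
    refine ⟨_, inter_mem_nhdsWithin _ hJ, measure_mono_null ?_
      (harc.volume_eq_zero hJα hψ₁ hψ₂ hψ₁' hψ₂' hsum)⟩
    rintro x ⟨⟨_, hx⟩, hxJ⟩
    refine ⟨hxJ, ?_⟩
    simpa only [Pi.neg_apply, mul_neg, nint_neg] using hx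
  · obtain ⟨J, hJ, M, α, hJα, harc⟩ := exists_nhds_isConvexArc hI hf hx₀.1 (h1 x₀ hx₀.1) h0
    refine ⟨_, inter_mem_nhdsWithin _ hJ, measure_mono_null ?_
      (harc.volume_eq_zero hJα hψ₁ hψ₂ hψ₁' hψ₂' hsum)⟩
    rintro x ⟨⟨_, hx⟩, hxJ⟩
    exact ⟨hxJ, hx⟩

theorem lipschitzOnWith_graph {f : ℝ → ℝ} {I : Set ℝ} {K : NNReal} (hf : LipschitzOnWith K f I) :
    LipschitzOnWith (1 + K) (fun x => (!₂[x, f x] : EuclideanSpace ℝ (Fin 2))) I := by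
  refine LipschitzOnWith.of_dist_le_mul fun x hx y hy => ?_
  rw [EuclideanSpace.dist_eq]
  simp only [Fin.sum_univ_two, Matrix.cons_val_zero, Matrix.cons_val_one]
  have h1 := hf.dist_le_mul x hx y hy
  refine Real.sqrt_le_iff.2 ⟨by positivity, ?_⟩
  have h2 : dist (f x) (f y) ^ 2 ≤ (K * dist x y) ^ 2 := by gcongr
  have h3 : 0 ≤ K * dist x y * dist x y := by positivity
  push_cast
  nlinarith

/-- **Theorem 1** (simultaneous convergence result on planar curves): if
`Σ_h ψ₁(h) ψ₂(h) < ∞` then `ℋ¹(C_f ∩ S₂(ψ₁, ψ₂)) = 0`; equivalently, the set of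
`x ∈ I` with `(x, f(x)) ∈ S₂(ψ₁, ψ₂)` has Lebesgue measure zero. -/
theorem curve_inter_S2_measure_zero
    (I : Set ℝ) (hIopen : IsOpen I) (hIconn : I.OrdConnected)
    (f : ℝ → ℝ) (hf : ContDiffOn ℝ 3 f I)
    (c₁ c₂ : ℝ) (hc₂pos : 0 < c₂) (hc₂₁ : c₂ < c₁)
    (hderiv : ∀ x ∈ I, c₂ < deriv f x ∧ deriv f x < c₁)
    (hderiv2 : ∀ x ∈ I, iteratedDeriv 2 f x ≠ 0)
    (ψ₁ ψ₂ : ℕ → ℝ) (hψ₁pos : ∀ q, 0 < ψ₁ q) (hψ₁dec : Antitone ψ₁)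
    (hψ₂pos : ∀ q, 0 < ψ₂ q) (hψ₂dec : Antitone ψ₂)
    (hsum : Summable (fun h : ℕ => ψ₁ h * ψ₂ h)) :
    μH[(1 : ℝ)] ({ p : EuclideanSpace ℝ (Fin 2) | p 0 ∈ I ∧ p 1 = f (p 0) } ∩ S2 ψ₁ ψ₂) = 0 ∧
    volume {x : ℝ | x ∈ I ∧
      {q : ℕ | 0 < q ∧ nint (q * x) < ψ₁ q ∧ nint (q * f x) < ψ₂ q}.Infinite} = 0 := by
  have hvol := volume_curve_inter_eq_zero hIopen (hf.of_le (by norm_num))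
    (fun x hx => (hc₂pos.trans (hderiv x hx).1).ne') hderiv2 (fun q => (hψ₁pos q).le)
    (fun q => (hψ₂pos q).le) hψ₁dec hψ₂dec hsum
  refine ⟨?_, hvol⟩
  have hlip : LipschitzOnWith c₁.toNNReal f I := by
    refine hIconn.convex.lipschitzOnWith_of_nnnorm_deriv_le
      (fun x hx => (hf.differentiableOn (by norm_num)).differentiableAt (hIopen.mem_nhds hx))
      fun x hx => ?_
    rw [← NNReal.coe_le_coe, coe_nnnorm, Real.coe_toNNReal _ (hc₂pos.trans hc₂₁).le,
      Real.norm_of_nonneg (hc₂pos.trans (hderiv x hx).1).le]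
    exact (hderiv x hx).2.le
  have hnull := ((lipschitzOnWith_graph hlip).mono fun x hx => hx.1).hausdorffMeasure_image_le
    (s := {x : ℝ | x ∈ I ∧
      {q : ℕ | 0 < q ∧ nint (q * x) < ψ₁ q ∧ nint (q * f x) < ψ₂ q}.Infinite}) zero_le_one
  rw [hausdorffMeasure_real, hvol, mul_zero] at hnull
  refine measure_mono_null ?_ (le_antisymm hnull zero_le)
  rintro p ⟨⟨hp, hp1⟩, hS⟩
  refine ⟨p 0, ⟨hp, by simpa only [S2, Set.mem_ofPred_eq, hp1] using hS⟩, ?_⟩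
  ext i
  fin_cases i <;> simp [hp1]
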